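/- arXiv:2111.10674 — 3 statements merged into one kernel-verified Lean document; each statement's English description precedes it below -/
import Mathlib

section
/- Fix 0 ≤ α ≤ 1. Let M be an α-moral mechanism for selling one item to n players whose values are drawn i.i.d. from a standard discrete distribution F on V = {0, ε, …, 1}. Then there exists a dominant-strategy (truthful) mechanism M' whose expected revenue is at least as large as the expected revenue of M. -/
open scoped NNReal
open Finset

/-- A deterministic direct mechanism for selling a single item to `n` players:
`alloc v = some i` means player `i` gets the item, `alloc v = none` means the
item is unallocated; `pay v i` is the payment of player `i`. -/
structure Mechanism (n : ℕ) where
  alloc : (Fin n → ℝ≥0) → Option (Fin n)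
  pay : (Fin n → ℝ≥0) → Fin n → ℝ

namespace Mechanism

variable {n : ℕ}

/-- The profit of player `i` with true value `t` when the submitted bid vector is `b`:
`π = t·[i wins at b] − pay(b)_i`. -/
def util (M : Mechanism n) (b : Fin n → ℝ≥0) (i : Fin n) (t : ℝ≥0) : ℝ :=
  (if M.alloc b = some i then (t : ℝ) else 0) - M.pay b i

/-- Individual rationality. -/
def IR (M : Mechanism n) : Prop :=
  ∀ v i, M.pay v i ≤ if M.alloc v = some i then ((v i : ℝ)) else 0

/-- No positive transfers. -/
def NPT (M : Mechanism n) : Prop := ∀ v i, 0 ≤ M.pay v i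

/-- `α`-moral mechanism: individually rational, no positive transfers, and whenever a
misreport `r` of player `i` strictly increases his profit (compared to truth-telling),
the gain is at most `α` times the total loss the misreport causes to the other players. -/
def Moral (α : ℝ) (M : Mechanism n) : Prop :=
  M.IR ∧ M.NPT ∧
  ∀ (v : Fin n → ℝ≥0) (i : Fin n) (r : ℝ≥0),
    0 < M.util (Function.update v i r) i (v i) - M.util v i (v i) →
    M.util (Function.update v i r) i (v i) - M.util v i (v i) ≤
      α * ∑ j ∈ Finset.univ.erase i,
        (M.util v j (v j) - M.util (Function.update v i r) j (v j))

/-- Truth-telling is a dominant strategy. -/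
def DominantStrategy (M : Mechanism n) : Prop :=
  ∀ (v : Fin n → ℝ≥0) (i : Fin n) (r : ℝ≥0),
    M.util (Function.update v i r) i (v i) ≤ M.util v i (v i)

end Mechanism

/-- Expected revenue of `M` when the `n` values are drawn i.i.d. from the discrete
distribution with pdf `g` on the grid `{0, ε, …, mε}`. -/
noncomputable def expRev (n m : ℕ) (ε : ℝ≥0) (g : ℕ → ℝ) (M : Mechanism n) : ℝ :=
  ∑ k : Fin n → Fin (m + 1),
    (∏ i, g ((k i : ℕ))) * ∑ i, M.pay (fun i => ((k i : ℕ) : ℝ≥0) * ε) i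

section Grid

variable {n m : ℕ}

/-- The bid vector on the grid of mesh `ε` with index vector `x`. -/
noncomputable def gridBid (ε : ℝ≥0) (x : Fin n → Fin (m + 1)) : Fin n → ℝ≥0 :=
  fun i => ((x i : ℕ) : ℝ≥0) * ε

lemma gridBid_update (ε : ℝ≥0) (x : Fin n → Fin (m + 1)) (i : Fin n) (s : Fin (m + 1)) :
    gridBid ε (Function.update x i s) = Function.update (gridBid ε x) i (((s : ℕ) : ℝ≥0) * ε) := by
  funext j
  rcases eq_or_ne j i with rfl | h
  · simp [gridBid]
  · simp [gridBid, h]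

/-- Summing over a vector and a fresh entry is invariant under exchanging the fresh entry with
coordinate `i` of the vector. -/
lemma sum_sum_update {ι β : Type*} [Fintype ι] [DecidableEq ι] [Fintype β] (i : ι)
    (h : (ι → β) → β → ℝ) :
    ∑ x, ∑ s, h x s = ∑ x, ∑ s, h (Function.update x i s) (x i) := by
  classical
  rw [← Fintype.sum_prod_type', ← Fintype.sum_prod_type'
    (f := fun x s => h (Function.update x i s) (x i))]
  let e : (ι → β) × β → (ι → β) × β := fun q => (Function.update q.1 i q.2, q.1 i)
  have he : Function.Involutive e := fun q => by simp [e]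
  exact (Equiv.sum_comp he.toPerm (fun q => h q.1 q.2)).symm

open Classical in
/-- The number of indices below the strict maximum `x i` with which `i` would still win. -/
noncomputable def charge (win : (Fin n → Fin (m + 1)) → Fin n → Prop) (i : Fin n)
    (x : Fin n → Fin (m + 1)) : ℝ :=
  ∑ s : Fin (m + 1),
    if s < x i ∧ (∀ j ≠ i, x j < x i) ∧ win (Function.update x i s) i then 1 else 0

/-- The probability of exceeding every entry of `x`. -/
noncomputable def tailMass (g : ℕ → ℝ) (x : Fin n → Fin (m + 1)) : ℝ :=
  ∑ s : Fin (m + 1), if ∀ j, x j < s then g s else 0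

/-- The contribution of the profile `x` to the virtual surplus when `i` wins, where the
information rent is only collected on values of `i` above the maximum of `x`. -/
noncomputable def virtualSurplus (ε : ℝ≥0) (g : ℕ → ℝ) (i : Fin n)
    (x : Fin n → Fin (m + 1)) : ℝ :=
  (∏ j, g (x j)) * ((x i : ℕ) * (ε : ℝ)) - ε * ((∏ j ∈ univ.erase i, g (x j)) * tailMass g x)

lemma sum_mul_charge (g : ℕ → ℝ) (win : (Fin n → Fin (m + 1)) → Fin n → Prop)
    [∀ x i, Decidable (win x i)] (i : Fin n) :
    ∑ x : Fin n → Fin (m + 1), (∏ j, g (x j)) * charge win i x =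
      ∑ x : Fin n → Fin (m + 1),
        if win x i then (∏ j ∈ univ.erase i, g (x j)) * tailMass g x else 0 := by
  simp only [charge, mul_sum]
  rw [sum_sum_update i]
  refine sum_congr rfl fun x _ => ?_
  have hprod (s : Fin (m + 1)) : ∏ j, g (Function.update x i s j) =
      g s * ∏ j ∈ univ.erase i, g (x j) := by
    rw [← mul_prod_erase univ _ (mem_univ i)]
    simp only [Function.update_self]
    congr 1
    refine prod_congr rfl fun j hj => ?_
    rw [Function.update_of_ne (ne_of_mem_erase hj)]
  have hcond (s : Fin (m + 1)) :
      (x i < s ∧ ∀ j ≠ i, Function.update x i s j < s) ↔ ∀ j, x j < s := by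
    constructor
    · rintro ⟨h1, h2⟩ j
      rcases eq_or_ne j i with rfl | h
      · exact h1
      · simpa [h] using h2 j h
    · intro h
      exact ⟨h i, fun j hj => by simpa [hj] using h j⟩
  simp only [Function.update_self, Function.update_idem, Function.update_eq_self, hprod,
    ← and_assoc, hcond]
  by_cases hw : win x i
  · simp only [hw, and_true, if_true, tailMass, mul_sum]
    refine sum_congr rfl fun s _ => ?_
    split_ifs <;> ring
  · simp [hw]

lemma sum_surplus_sub_charge (ε : ℝ≥0) (g : ℕ → ℝ)
    (win : (Fin n → Fin (m + 1)) → Fin n → Prop) [∀ x i, Decidable (win x i)] :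
    ∑ x : Fin n → Fin (m + 1), (∏ j, g (x j)) *
      ∑ i, ((if win x i then ((x i : ℕ) : ℝ) * (ε : ℝ) else 0) - ε * charge win i x) =
    ∑ x : Fin n → Fin (m + 1), ∑ i, if win x i then virtualSurplus ε g i x else 0 := by
  simp only [mul_sum]
  rw [sum_comm, sum_comm (s := univ (α := Fin n → Fin (m + 1))) (t := univ (α := Fin n))]
  refine sum_congr rfl fun i _ => ?_
  have h := congrArg (fun z => (ε : ℝ) * z) (sum_mul_charge g win i)
  simp only [mul_sum] at h
  simp only [mul_sub, sum_sub_distrib]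
  rw [show ∑ x : Fin n → Fin (m + 1), (∏ j, g (x j)) * ((ε : ℝ) * charge win i x) =
    ∑ x : Fin n → Fin (m + 1), (ε : ℝ) * ((∏ j, g (x j)) * charge win i x) from
    sum_congr rfl fun x _ => by ring, h, ← sum_sub_distrib]
  refine sum_congr rfl fun x _ => ?_
  by_cases hw : win x i <;> simp [hw, virtualSurplus]

lemma charge_nonneg (win : (Fin n → Fin (m + 1)) → Fin n → Prop) (i : Fin n)
    (x : Fin n → Fin (m + 1)) : 0 ≤ charge win i x := by
  classical
  exact sum_nonneg fun s _ => by split_ifs <;> norm_num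

lemma charge_eq_card (win : (Fin n → Fin (m + 1)) → Fin n → Prop) (i : Fin n)
    (x : Fin n → Fin (m + 1)) [DecidablePred fun s : Fin (m + 1) =>
      s < x i ∧ (∀ j ≠ i, x j < x i) ∧ win (Function.update x i s) i] :
    charge win i x = #{s : Fin (m + 1) |
      s < x i ∧ (∀ j ≠ i, x j < x i) ∧ win (Function.update x i s) i} := by
  rw [← sum_boole, charge]
  congr!

/-- The tail mass of a profile is the tail of the distribution at the largest entry. -/
lemma tailMass_eq (g : ℕ → ℝ) (hgsum : ∑ k ∈ range (m + 1), g k = 1)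
    (x : Fin n → Fin (m + 1)) (w : Fin n) (hw : ∀ j, x j ≤ x w) :
    tailMass g x = 1 - ∑ k ∈ range ((x w : ℕ) + 1), g k := by
  have hcond (s : Fin (m + 1)) : (∀ j, x j < s) ↔ (x w : ℕ) < (s : ℕ) :=
    ⟨fun h => h w, fun h j => lt_of_le_of_lt (hw j) h⟩
  simp only [tailMass, hcond]
  rw [Fin.sum_univ_eq_sum_range (fun s => if (x w : ℕ) < s then g s else 0) (m + 1), ← hgsum,
    ← sum_filter, ← sum_filter_add_sum_filter_not (range (m + 1)) (fun s => (x w : ℕ) < s)]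
  have : {s ∈ range (m + 1) | ¬ (x w : ℕ) < s} = range ((x w : ℕ) + 1) := by
    ext s
    have := (x w).isLt
    simp only [mem_filter, mem_range]
    omega
  rw [this]
  ring

/-- The virtual value of index `k`. -/
noncomputable def virtualValue (ε : ℝ≥0) (g : ℕ → ℝ) (k : ℕ) : ℝ :=
  (k : ℝ) * (ε : ℝ) - (ε : ℝ) * (1 - ∑ j ∈ range (k + 1), g j) / g k

lemma virtualValue_mono (ε : ℝ≥0) (g : ℕ → ℝ) (hgpos : ∀ k ≤ m, 0 < g k)
    (hstd : ∀ k k' : ℕ, k ≤ m → k' < k →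
      (k' : ℝ) * (ε : ℝ) - (ε : ℝ) * (1 - ∑ j ∈ Finset.range (k + 1), g j) / g k' ≤
        (k : ℝ) * (ε : ℝ) - (ε : ℝ) * (1 - ∑ j ∈ Finset.range (k + 1), g j) / g k)
    {k k' : ℕ} (hk : k ≤ m) (hkk : k' ≤ k) : virtualValue ε g k' ≤ virtualValue ε g k := by
  rcases hkk.eq_or_lt with rfl | hlt
  · exact le_rfl
  refine le_trans ?_ (hstd k k' hk hlt)
  have hpos := hgpos k' (hkk.trans hk)
  have hsum : ∑ j ∈ range (k' + 1), g j ≤ ∑ j ∈ range (k + 1), g j :=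
    sum_le_sum_of_subset_of_nonneg (range_subset_range.2 (by omega)) fun j hj _ =>
      (hgpos j (by have := mem_range.1 hj; omega)).le
  unfold virtualValue
  gcongr

lemma virtualSurplus_eq (ε : ℝ≥0) (g : ℕ → ℝ) (hgpos : ∀ k ≤ m, 0 < g k) (i : Fin n)
    (x : Fin n → Fin (m + 1)) : virtualSurplus ε g i x =
      (∏ j, g (x j)) * ((x i : ℕ) * (ε : ℝ) - ε * tailMass g x / g (x i)) := by
  have hpos := hgpos (x i) (Nat.lt_succ_iff.1 (x i).isLt)
  rw [virtualSurplus, ← mul_prod_erase univ (fun j => g (x j)) (mem_univ i)]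
  field_simp

lemma virtualSurplus_max (ε : ℝ≥0) (g : ℕ → ℝ) (hgpos : ∀ k ≤ m, 0 < g k)
    (hgsum : ∑ k ∈ range (m + 1), g k = 1)
    (x : Fin n → Fin (m + 1)) (w : Fin n) (hw : ∀ j, x j ≤ x w) :
    virtualSurplus ε g w x = (∏ j, g (x j)) * virtualValue ε g (x w) := by
  rw [virtualSurplus_eq ε g hgpos, tailMass_eq g hgsum x w hw, virtualValue]

lemma virtualSurplus_le (ε : ℝ≥0) (g : ℕ → ℝ) (hgpos : ∀ k ≤ m, 0 < g k)
    (hgsum : ∑ k ∈ range (m + 1), g k = 1)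
    (hstd : ∀ k k' : ℕ, k ≤ m → k' < k →
      (k' : ℝ) * (ε : ℝ) - (ε : ℝ) * (1 - ∑ j ∈ Finset.range (k + 1), g j) / g k' ≤
        (k : ℝ) * (ε : ℝ) - (ε : ℝ) * (1 - ∑ j ∈ Finset.range (k + 1), g j) / g k)
    (x : Fin n → Fin (m + 1)) (w : Fin n) (hw : ∀ j, x j ≤ x w) (i : Fin n) :
    virtualSurplus ε g i x ≤ (∏ j, g (x j)) * virtualValue ε g (x w) := by
  have hprod : 0 ≤ ∏ j, g (x j) :=
    prod_nonneg fun j _ => (hgpos _ (Nat.lt_succ_iff.1 (x j).isLt)).le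
  rw [virtualSurplus_eq ε g hgpos, tailMass_eq g hgsum x w hw]
  refine mul_le_mul_of_nonneg_left ?_ hprod
  rcases (hw i).eq_or_lt with h | h
  · rw [h, virtualValue]
  · exact hstd _ _ (Nat.lt_succ_iff.1 (x w).isLt) h

end Grid

namespace Mechanism

variable {n m : ℕ}

lemma util_nonneg {M : Mechanism n} (h : M.IR) (v : Fin n → ℝ≥0) (i : Fin n) :
    0 ≤ M.util v i (v i) :=
  sub_nonneg.2 (h v i)

/-- In a moral mechanism no player can, by misreporting, get more than the total truthful
profit of all players. -/
lemma Moral.util_update_le {α : ℝ} (hα0 : 0 ≤ α) (hα1 : α ≤ 1) {M : Mechanism n}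
    (hM : M.Moral α) (v : Fin n → ℝ≥0) (i : Fin n) (r : ℝ≥0) :
    M.util (Function.update v i r) i (v i) ≤ ∑ j, M.util v j (v j) := by
  obtain ⟨hIR, -, hmor⟩ := hM
  rw [← add_sum_erase univ _ (mem_univ i)]
  have hS : 0 ≤ ∑ j ∈ univ.erase i, M.util v j (v j) :=
    sum_nonneg fun j _ => util_nonneg hIR v j
  rcases le_or_gt (M.util (Function.update v i r) i (v i) - M.util v i (v i)) 0 with h | h
  · linarith
  · have h1 := hmor v i r h
    have h2 : ∑ j ∈ univ.erase i, (M.util v j (v j) - M.util (Function.update v i r) j (v j)) ≤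
        ∑ j ∈ univ.erase i, M.util v j (v j) := by
      refine sum_le_sum fun j hj => ?_
      have := util_nonneg hIR (Function.update v i r) j
      rw [Function.update_of_ne (ne_of_mem_erase hj)] at this
      linarith
    have h3 := mul_le_mul_of_nonneg_left h2 hα0
    have h4 := mul_le_of_le_one_left hS hα1
    linarith

/-- The total profit at a grid profile covers the charges. -/
lemma Moral.sum_charge_le {α : ℝ} (hα0 : 0 ≤ α) (hα1 : α ≤ 1) {M : Mechanism n}
    (hM : M.Moral α) (ε : ℝ≥0) (x : Fin n → Fin (m + 1)) :
    ∑ i, (ε : ℝ) * charge (fun y i => M.alloc (gridBid ε y) = some i) i x ≤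
      ∑ i, M.util (gridBid ε x) i (gridBid ε x i) := by
  classical
  set win : (Fin n → Fin (m + 1)) → Fin n → Prop :=
    fun y i => M.alloc (gridBid ε y) = some i with hwin
  by_cases hz : ∀ i, charge win i x = 0
  · simp only [hz, mul_zero, sum_const_zero]
    exact sum_nonneg fun i _ => util_nonneg hM.1 _ i
  push Not at hz
  obtain ⟨i, hi⟩ := hz
  rw [charge_eq_card] at hi
  obtain ⟨s, hs, hmin⟩ := exists_min_image _ (fun s : Fin (m + 1) => s)
    (card_ne_zero.1 (by exact_mod_cast hi))
  obtain ⟨hsx, hmax, hsw⟩ := (mem_filter.1 hs).2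
  rw [sum_eq_single i (fun j _ hj => ?_) (by simp)]
  · refine le_trans ?_ (hM.util_update_le hα0 hα1 (gridBid ε x) i (((s : ℕ) : ℝ≥0) * ε))
    have hcard : charge win i x ≤ ((x i : ℕ) : ℝ) - (s : ℕ) := by
      rw [charge_eq_card, ← Nat.cast_sub hsx.le, ← Fin.card_Ico]
      exact_mod_cast card_le_card fun t ht => mem_Ico.2 ⟨hmin t ht, (mem_filter.1 ht).2.1⟩
    rw [← gridBid_update]
    have hpay := hM.1 (gridBid ε (Function.update x i s)) i
    rw [if_pos hsw] at hpay
    rw [util, if_pos hsw]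
    simp only [gridBid, Function.update_self, NNReal.coe_mul, NNReal.coe_natCast] at hpay ⊢
    have := mul_le_mul_of_nonneg_left hcard ε.coe_nonneg
    linarith
  · rw [charge_eq_card, filter_false_of_mem, card_empty, Nat.cast_zero, mul_zero]
    rintro t - ⟨-, h, -⟩
    exact lt_asymm (hmax j hj) (h i hj.symm)

lemma Moral.expRev_le {α : ℝ} (hα0 : 0 ≤ α) (hα1 : α ≤ 1) {M : Mechanism n}
    (hM : M.Moral α) (ε : ℝ≥0) (g : ℕ → ℝ) (hgpos : ∀ k ≤ m, 0 < g k) :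
    expRev n m ε g M ≤ ∑ x : Fin n → Fin (m + 1), ∑ i,
      if M.alloc (gridBid ε x) = some i then virtualSurplus ε g i x else 0 := by
  rw [← sum_surplus_sub_charge ε g
    (fun (y : Fin n → Fin (m + 1)) i => M.alloc (gridBid ε y) = some i)]
  refine sum_le_sum fun x _ => mul_le_mul_of_nonneg_left ?_
    (prod_nonneg fun j _ => (hgpos _ (Nat.lt_succ_iff.1 (x j).isLt)).le)
  change ∑ i, M.pay (gridBid ε x) i ≤ _
  have h := hM.sum_charge_le hα0 hα1 ε x
  simp only [util, sum_sub_distrib, gridBid, NNReal.coe_mul, NNReal.coe_natCast] at h ⊢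
  linarith

/-- The index of the price offered to player `i` in the second-price auction on the grid with
reserve index `r`, ties being broken in favour of smaller players. -/
noncomputable def threshold (r : ℕ) (ε : ℝ≥0) (v : Fin n → ℝ≥0) (i : Fin n) : ℕ :=
  max r ((univ.erase i).sup fun j => ⌊v j / ε⌋₊ + if j < i then 1 else 0)

open Classical in
/-- The second-price auction with reserve index `r` on the grid of mesh `ε`. -/
noncomputable def reserveAuction (r : ℕ) (ε : ℝ≥0) : Mechanism n where
  alloc v := if h : ∃ i, (threshold r ε v i : ℝ≥0) * ε ≤ v i then some h.choose else none
  pay v i := if (threshold r ε v i : ℝ≥0) * ε ≤ v i then (threshold r ε v i : ℝ) * ε else 0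

lemma threshold_update (r : ℕ) (ε : ℝ≥0) (v : Fin n → ℝ≥0) (i : Fin n) (s : ℝ≥0) :
    threshold r ε (Function.update v i s) i = threshold r ε v i := by
  unfold threshold
  congr 1
  refine sup_congr rfl fun j hj => ?_
  rw [Function.update_of_ne (ne_of_mem_erase hj)]

lemma le_threshold (r : ℕ) (ε : ℝ≥0) (v : Fin n → ℝ≥0) {i j : Fin n} (h : j ≠ i) :
    (⌊v j / ε⌋₊ + if j < i then 1 else 0) ≤ threshold r ε v i :=
  le_max_of_le_right (le_sup (f := fun j => ⌊v j / ε⌋₊ + if j < i then 1 else 0)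
    (mem_erase.2 ⟨h, mem_univ j⟩))

lemma threshold_win_unique (r : ℕ) {ε : ℝ≥0} (hε : 0 < ε) (v : Fin n → ℝ≥0) {i j : Fin n}
    (hi : (threshold r ε v i : ℝ≥0) * ε ≤ v i) (hj : (threshold r ε v j : ℝ≥0) * ε ≤ v j) :
    i = j := by
  by_contra hne
  have h1 := Nat.le_floor ((le_div_iff₀ hε).2 hi)
  have h2 := Nat.le_floor ((le_div_iff₀ hε).2 hj)
  have h3 := le_threshold r ε v hne
  have h4 := le_threshold r ε v (Ne.symm hne)
  rcases lt_or_gt_of_ne hne with h | h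
  · rw [if_pos h] at h3
    omega
  · rw [if_pos h] at h4
    omega

lemma reserveAuction_alloc_eq_some (r : ℕ) {ε : ℝ≥0} (hε : 0 < ε) (v : Fin n → ℝ≥0)
    (i : Fin n) : (reserveAuction r ε).alloc v = some i ↔
      (threshold r ε v i : ℝ≥0) * ε ≤ v i := by
  unfold reserveAuction
  constructor
  · intro h
    dsimp only at h
    split_ifs at h with hex
    rw [← Option.some.inj h]
    exact hex.choose_spec
  · intro h
    have hex : ∃ i, (threshold r ε v i : ℝ≥0) * ε ≤ v i := ⟨i, h⟩
    dsimp only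
    rw [dif_pos hex, threshold_win_unique r hε v hex.choose_spec h]

lemma reserveAuction_util (r : ℕ) {ε : ℝ≥0} (hε : 0 < ε) (v : Fin n → ℝ≥0) (i : Fin n)
    (t : ℝ≥0) : (reserveAuction r ε).util v i t =
      if (threshold r ε v i : ℝ≥0) * ε ≤ v i then (t : ℝ) - threshold r ε v i * ε else 0 := by
  simp only [util, reserveAuction_alloc_eq_some r hε]
  simp only [reserveAuction]
  split_ifs <;> simp

lemma reserveAuction_IR (r : ℕ) {ε : ℝ≥0} (hε : 0 < ε) :
    (reserveAuction r ε : Mechanism n).IR := by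
  intro v i
  simp only [reserveAuction_alloc_eq_some r hε]
  simp only [reserveAuction]
  split_ifs with h
  · exact_mod_cast h
  · exact le_rfl

lemma reserveAuction_NPT (r : ℕ) (ε : ℝ≥0) : (reserveAuction r ε : Mechanism n).NPT := by
  intro v i
  simp only [reserveAuction]
  split_ifs <;> positivity

lemma reserveAuction_dominantStrategy (r : ℕ) {ε : ℝ≥0} (hε : 0 < ε) :
    (reserveAuction r ε : Mechanism n).DominantStrategy := by
  intro v i s
  simp only [reserveAuction_util r hε, threshold_update]
  by_cases h : (threshold r ε v i : ℝ≥0) * ε ≤ v i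
  · have : (threshold r ε v i : ℝ) * ε ≤ v i := by exact_mod_cast h
    rw [if_pos h]
    split_ifs <;> linarith
  · have : (v i : ℝ) ≤ threshold r ε v i * ε := by exact_mod_cast (not_le.1 h).le
    rw [if_neg h]
    split_ifs <;> linarith

lemma threshold_gridBid (r : ℕ) {ε : ℝ≥0} (hε : 0 < ε) (x : Fin n → Fin (m + 1)) (i : Fin n) :
    threshold r ε (gridBid ε x) i =
      max r ((univ.erase i).sup fun j => (x j : ℕ) + if j < i then 1 else 0) := by
  simp [threshold, gridBid, hε.ne']

lemma reserveAuction_alloc_gridBid (r : ℕ) {ε : ℝ≥0} (hε : 0 < ε) (x : Fin n → Fin (m + 1))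
    (i : Fin n) : (reserveAuction r ε).alloc (gridBid ε x) = some i ↔
      threshold r ε (gridBid ε x) i ≤ x i := by
  rw [reserveAuction_alloc_eq_some r hε, gridBid, mul_le_mul_iff_left₀ hε, Nat.cast_le]

/-- The profit of a player in the reserve auction is at most his charge. -/
lemma reserveAuction_le_pay (r : ℕ) {ε : ℝ≥0} (hε : 0 < ε) (x : Fin n → Fin (m + 1))
    (i : Fin n) :
    (if (reserveAuction r ε).alloc (gridBid ε x) = some i then
        ((x i : ℕ) : ℝ) * (ε : ℝ) else 0) -
      ε * charge (fun y i => (reserveAuction r ε).alloc (gridBid ε y) = some i) i x ≤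
    (reserveAuction r ε).pay (gridBid ε x) i := by
  classical
  set win : (Fin n → Fin (m + 1)) → Fin n → Prop :=
    fun y i => (reserveAuction r ε).alloc (gridBid ε y) = some i with hwin
  have hc := mul_nonneg ε.coe_nonneg (charge_nonneg win i x)
  by_cases h : (reserveAuction r ε).alloc (gridBid ε x) = some i
  swap
  · rw [if_neg h]
    linarith [reserveAuction_NPT r ε (gridBid ε x) i]
  rw [if_pos h]
  have hpay : (reserveAuction r ε).pay (gridBid ε x) i =
      (threshold r ε (gridBid ε x) i : ℝ) * ε :=
    if_pos ((reserveAuction_alloc_eq_some r hε _ _).1 h)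
  have ht := (reserveAuction_alloc_gridBid r hε x i).1 h
  let t : Fin (m + 1) := ⟨threshold r ε (gridBid ε x) i, ht.trans_lt (x i).isLt⟩
  have hcard : ((x i : ℕ) : ℝ) - (t : ℕ) ≤ charge win i x := by
    rw [charge_eq_card, ← Nat.cast_sub (show (t : ℕ) ≤ x i from ht), ← Fin.card_Ico]
    refine Nat.cast_le.2 (card_le_card fun s hs => ?_)
    obtain ⟨hts, hsx⟩ := mem_Ico.1 hs
    refine mem_filter.2 ⟨mem_univ _, hsx, fun j hj => ?_, ?_⟩
    · have h1 := le_threshold r ε (gridBid ε x) hj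
      have h2 : ⌊gridBid ε x j / ε⌋₊ = x j := by simp [gridBid, hε.ne']
      have h3 : threshold r ε (gridBid ε x) i ≤ s := hts
      have h4 : (s : ℕ) < x i := hsx
      exact Fin.lt_def.2 (by omega)
    · simp only [hwin]
      rw [reserveAuction_alloc_gridBid r hε, gridBid_update, threshold_update,
        Function.update_self]
      exact hts
  have := mul_le_mul_of_nonneg_left hcard ε.coe_nonneg
  rw [hpay]
  simp only [t] at this
  linarith

lemma le_expRev_reserveAuction (r : ℕ) {ε : ℝ≥0} (hε : 0 < ε) (g : ℕ → ℝ)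
    (hgpos : ∀ k ≤ m, 0 < g k) :
    ∑ x : Fin n → Fin (m + 1), ∑ i, (if (reserveAuction r ε).alloc (gridBid ε x) = some i then
      virtualSurplus ε g i x else 0) ≤ expRev n m ε g (reserveAuction r ε) := by
  rw [← sum_surplus_sub_charge ε g
    (fun (y : Fin n → Fin (m + 1)) i => (reserveAuction r ε).alloc (gridBid ε y) = some i)]
  exact sum_le_sum fun x _ => mul_le_mul_of_nonneg_left
    (sum_le_sum fun i _ => reserveAuction_le_pay r hε x i)
    (prod_nonneg fun j _ => (hgpos _ (Nat.lt_succ_iff.1 (x j).isLt)).le)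

/-- In the reserve auction the first player with the largest value wins if he meets the
reserve, and otherwise nobody wins. -/
lemma exists_max_reserveAuction_alloc [NeZero n] (r : ℕ) {ε : ℝ≥0} (hε : 0 < ε)
    (x : Fin n → Fin (m + 1)) : ∃ w, (∀ j, x j ≤ x w) ∧
      (reserveAuction r ε).alloc (gridBid ε x) = if r ≤ x w then some w else none := by
  obtain ⟨u, -, hu⟩ := exists_max_image univ x univ_nonempty
  obtain ⟨w, hw, hmin⟩ := exists_min_image {j | x j = x u} id ⟨u, by simp⟩
  have hwu : x w = x u := (mem_filter.1 hw).2
  have hmax (j) : x j ≤ x w := hwu ▸ hu j (mem_univ j)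
  refine ⟨w, hmax, ?_⟩
  split_ifs with hr
  · rw [reserveAuction_alloc_gridBid r hε, threshold_gridBid r hε]
    refine max_le hr (Finset.sup_le fun j hj => ?_)
    have h1 : (x j : ℕ) ≤ x w := hmax j
    split_ifs with hjw
    · have h2 : x j ≠ x w := fun h =>
        absurd (hmin j (by simp [h, hwu])) (not_le.2 hjw)
      have h3 : (x j : ℕ) ≠ x w := fun h => h2 (Fin.ext h)
      omega
    · exact h1
  · rw [Option.eq_none_iff_forall_ne_some]
    intro i hi
    rw [reserveAuction_alloc_gridBid r hε] at hi
    exact hr ((le_max_left _ _).trans (hi.trans (hmax i)))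

end Mechanism

open Mechanism

theorem stmt10 (n m : ℕ) (hm : 0 < m) (ε : ℝ≥0) (hε : (ε : ℝ) = 1 / m)
    (g : ℕ → ℝ) (hgpos : ∀ k ≤ m, 0 < g k)
    (hgsum : ∑ k ∈ Finset.range (m + 1), g k = 1)
    (hstd : ∀ k k' : ℕ, k ≤ m → k' < k →
      (k' : ℝ) * (ε : ℝ) - (ε : ℝ) * (1 - ∑ j ∈ Finset.range (k + 1), g j) / g k' ≤
        (k : ℝ) * (ε : ℝ) - (ε : ℝ) * (1 - ∑ j ∈ Finset.range (k + 1), g j) / g k)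
    (α : ℝ) (hα0 : 0 ≤ α) (hα1 : α ≤ 1)
    (M : Mechanism n) (hM : M.Moral α) :
    ∃ M' : Mechanism n, M'.IR ∧ M'.NPT ∧ M'.DominantStrategy ∧
      expRev n m ε g M ≤ expRev n m ε g M' := by
  have hεpos : 0 < ε := by
    rw [← NNReal.coe_pos, hε]
    positivity
  rcases Nat.eq_zero_or_pos n with rfl | hn
  · exact ⟨reserveAuction 0 ε, reserveAuction_IR 0 hεpos, reserveAuction_NPT 0 ε,
      reserveAuction_dominantStrategy 0 hεpos, by simp [expRev]⟩
  have : NeZero n := ⟨hn.ne'⟩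
  classical
  have hex : ∃ k, k ≤ m ∧ 0 ≤ virtualValue ε g k := ⟨m, le_rfl, by
    rw [virtualValue, hgsum]
    simp only [sub_self, mul_zero, zero_div, sub_zero]
    positivity⟩
  let r := Nat.find hex
  refine ⟨reserveAuction r ε, reserveAuction_IR r hεpos, reserveAuction_NPT r ε,
    reserveAuction_dominantStrategy r hεpos, ?_⟩
  refine (hM.expRev_le hα0 hα1 ε g hgpos).trans
    (le_trans (sum_le_sum fun x _ => ?_) (le_expRev_reserveAuction r hεpos g hgpos))
  obtain ⟨w, hmax, halloc⟩ := exists_max_reserveAuction_alloc r hεpos x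
  have hle := virtualSurplus_le ε g hgpos hgsum hstd x w hmax
  have hprod : 0 ≤ ∏ j, g (x j) :=
    prod_nonneg fun j _ => (hgpos _ (Nat.lt_succ_iff.1 (x j).isLt)).le
  have hwm : (x w : ℕ) ≤ m := Nat.lt_succ_iff.1 (x w).isLt
  have hright : max 0 ((∏ j, g (x j)) * virtualValue ε g (x w)) ≤
      ∑ i, if (reserveAuction r ε).alloc (gridBid ε x) = some i then
        virtualSurplus ε g i x else 0 := by
    rw [halloc]
    by_cases hr : r ≤ x w
    · have h0 : 0 ≤ virtualValue ε g (x w) :=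
        (Nat.find_spec hex).2.trans (virtualValue_mono ε g hgpos hstd hwm hr)
      simp [hr, virtualSurplus_max ε g hgpos hgsum x w hmax, mul_nonneg hprod h0]
    · have h0 : virtualValue ε g (x w) ≤ 0 := by
        have := Nat.find_min hex (not_le.1 hr)
        push Not at this
        exact (this hwm).le
      simp [hr, mul_nonpos_of_nonneg_of_nonpos hprod h0]
  refine le_trans ?_ hright
  cases M.alloc (gridBid ε x) with
  | none => simp
  | some i => simp [hle i]
end

section
/- For every α with 0 < α ≤ 1 and all small enough ε, δ > 0, there exists a finitely-supported joint distribution H over the values of two players such that some α-moral mechanism achieves expected revenue at least e/(e−1) + δ + 1/(e−1) − ((e+1)/(e−1))·ε − ε·δ on H, whereas the expected revenue of every truthful (dominant-strategy, individually rational, no-positive-transfers) mechanism on H is at most e/(e−1) + δ. -/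
open scoped NNReal
open Finset

/-- A finite weighted family of points, pushed forward to a weight function on points. -/
theorem sum_image_pushforward {ι β : Type*} [DecidableEq β] (P : Finset ι) (pt : ι → β)
    (h : ι → ℝ) (F : β → ℝ) :
    ∑ v ∈ P.image pt, (∑ i ∈ P, if pt i = v then h i else 0) * F v =
      ∑ i ∈ P, h i * F (pt i) := by
  simp_rw [Finset.sum_mul]
  rw [Finset.sum_comm]
  refine Finset.sum_congr rfl fun i hi => ?_
  rw [Finset.sum_eq_single_of_mem (pt i) (Finset.mem_image_of_mem _ hi)]
  · simp
  · intro b _ hb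
    simp [hb.symm]

namespace Mechanism

variable {n : ℕ} {M : Mechanism n}

theorem IR.pay_le_zero (hIR : M.IR) {v : Fin n → ℝ≥0} {i : Fin n} (h : M.alloc v ≠ some i) :
    M.pay v i ≤ 0 := by
  simpa [h] using hIR v i

theorem IR.pay_le (hIR : M.IR) (v : Fin n → ℝ≥0) (i : Fin n) : M.pay v i ≤ v i :=
  (hIR v i).trans (by split_ifs <;> simp)

/-- In a truthful mechanism a winner keeps winning after raising the bid. -/
theorem DominantStrategy.alloc_update (hDS : M.DominantStrategy) (hIR : M.IR) (hNPT : M.NPT)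
    {v : Fin n → ℝ≥0} {i : Fin n} {r : ℝ≥0} (hr : v i < r) (h : M.alloc v = some i) :
    M.alloc (Function.update v i r) = some i := by
  by_contra hne
  have h1 := hDS (Function.update v i r) i (v i)
  have h2 := hIR.pay_le v i
  have h3 := hNPT (Function.update v i r) i
  have h4 : (v i : ℝ) < r := by exact_mod_cast hr
  simp [util, h, hne] at h1
  linarith

/-- In a truthful mechanism all winning bids of a player cost the same. -/
theorem DominantStrategy.pay_le (hDS : M.DominantStrategy)
    {v : Fin n → ℝ≥0} {i : Fin n} {r : ℝ≥0} (h : M.alloc v = some i)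
    (h' : M.alloc (Function.update v i r) = some i) :
    M.pay v i ≤ M.pay (Function.update v i r) i := by
  have h1 := hDS v i r
  simp [util, h, h'] at h1
  linarith

/-- Revenue bound for truthful mechanisms on a triangular array of weights `h k j` placed at the
points `(x k, w j)`, where `x` increases, `w` decreases and every `x k` is at most `s`. -/
theorem DominantStrategy.revenue_le {M : Mechanism 2} (hDS : M.DominantStrategy) (hIR : M.IR)
    (hNPT : M.NPT) {x w : ℕ → ℝ≥0} (hx : StrictMono x) (hw : StrictAnti w) {s : ℝ}
    (hxs : ∀ k, (x k : ℝ) ≤ s) {N : ℕ} {h : ℕ → ℕ → ℝ} {r : ℕ → ℝ} (hh : ∀ k j, 0 ≤ h k j)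
    (h_lt : ∀ k j, j < k → h k j = 0) (hr : ∀ k, 0 ≤ r k)
    (h_row : ∀ k J, k ≤ J → (w J : ℝ) * ∑ j ∈ Icc k J, h k j ≤ s * r k)
    (h_col : ∀ j ∈ range N, ∑ k ∈ range N, h k j ≤ r j) :
    ∑ k ∈ range N, ∑ j ∈ range N, h k j * ∑ i, M.pay ![x k, w j] i ≤
      s * ∑ k ∈ range N, r k := by
  classical
  have hs : 0 ≤ s := (x 0).2.trans (hxs 0)
  have upd0 : ∀ k j k', Function.update ![x k, w j] 0 (x k') = ![x k', w j] := by
    intro k j k'; ext i; fin_cases i <;> simp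
  have upd1 : ∀ k j j', Function.update ![x k, w j] 1 (w j') = ![x k, w j'] := by
    intro k j j'; ext i; fin_cases i <;> simp
  have mono0 : ∀ k k' j, k ≤ k' → M.alloc ![x k, w j] = some 0 →
      M.alloc ![x k', w j] = some 0 := by
    intro k k' j hk ha
    rcases hk.eq_or_lt with rfl | hk
    · exact ha
    · rw [← upd0 k j k']
      exact hDS.alloc_update hIR hNPT (by simpa using hx hk) ha
  have mono1 : ∀ k j j', j' ≤ j → M.alloc ![x k, w j] = some 1 →
      M.alloc ![x k, w j'] = some 1 := by
    intro k j j' hj ha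
    rcases hj.eq_or_lt with rfl | hj
    · exact ha
    · rw [← upd1 k j j']
      exact hDS.alloc_update hIR hNPT (by simpa using hw hj) ha
  let τ : ℕ → ℝ := fun j => if M.alloc ![x j, w j] = some 0 then 1 else 0
  have hτ0 : ∀ j, 0 ≤ τ j := fun j => by simp only [τ]; split_ifs <;> norm_num
  have hτ1 : ∀ j, τ j ≤ 1 := fun j => by simp only [τ]; split_ifs <;> norm_num
  have cell : ∀ k j, h k j * ∑ i, M.pay ![x k, w j] i ≤
      (if k ≤ j ∧ M.alloc ![x k, w j] = some 1 then h k j * M.pay ![x k, w j] 1 else 0) +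
        h k j * (s * τ j) := by
    intro k j
    rcases lt_or_ge j k with hjk | hkj
    · simp [h_lt k j hjk]
    rw [Fin.sum_univ_two]
    have hτs : 0 ≤ h k j * (s * τ j) := mul_nonneg (hh k j) (mul_nonneg hs (hτ0 j))
    by_cases h1 : M.alloc ![x k, w j] = some 1
    · have h0 : M.pay ![x k, w j] 0 ≤ 0 := hIR.pay_le_zero (by simp [h1])
      simp only [hkj, h1, and_self, if_true]
      nlinarith [hh k j]
    · have h1' : M.pay ![x k, w j] 1 ≤ 0 := hIR.pay_le_zero h1
      simp only [h1, and_false, if_false, zero_add]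
      refine mul_le_mul_of_nonneg_left ?_ (hh k j)
      by_cases h0 : M.alloc ![x k, w j] = some 0
      · have hτ : τ j = 1 := by simp [τ, mono0 k j j hkj h0]
        have h2 : M.pay ![x k, w j] 0 ≤ x k := hIR.pay_le ![x k, w j] 0
        rw [hτ]
        linarith [hxs k]
      · have h2 : M.pay ![x k, w j] 0 ≤ 0 := hIR.pay_le_zero h0
        nlinarith [mul_nonneg hs (hτ0 j)]
  have row : ∀ k, ∑ j ∈ range N, h k j * ∑ i, M.pay ![x k, w j] i ≤
      s * (r k * (1 - τ k)) + ∑ j ∈ range N, h k j * (s * τ j) := by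
    intro k
    refine (Finset.sum_le_sum fun j _ => cell k j).trans ?_
    rw [Finset.sum_add_distrib, ← Finset.sum_filter]
    gcongr
    set R := (range N).filter fun j => k ≤ j ∧ M.alloc ![x k, w j] = some 1 with hR
    rcases R.eq_empty_or_nonempty with he | hne
    · rw [he, Finset.sum_empty]
      exact mul_nonneg hs (mul_nonneg (hr k) (sub_nonneg.2 (hτ1 k)))
    obtain ⟨-, hkJ, hJ⟩ := Finset.mem_filter.1 (R.max'_mem hne)
    set J := R.max' hne
    have hτ : τ k = 0 := by simp [τ, mono1 k J k hkJ hJ]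
    rw [hτ, sub_zero, mul_one]
    refine le_trans ?_ (h_row k J hkJ)
    rw [Finset.mul_sum]
    calc ∑ j ∈ R, h k j * M.pay ![x k, w j] 1
        ≤ ∑ j ∈ R, (w J : ℝ) * h k j := by
          refine Finset.sum_le_sum fun j hj => ?_
          obtain ⟨-, -, hj1⟩ := Finset.mem_filter.1 hj
          have h1 := hDS.pay_le (r := w J) hj1 (by rw [upd1]; exact hJ)
          rw [upd1] at h1
          have h2 : M.pay ![x k, w J] 1 ≤ w J := hIR.pay_le ![x k, w J] 1
          rw [mul_comm]
          exact mul_le_mul_of_nonneg_right (h1.trans h2) (hh k j)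
      _ ≤ ∑ j ∈ Icc k J, (w J : ℝ) * h k j := by
          refine Finset.sum_le_sum_of_subset_of_nonneg (fun j hj => ?_)
            fun j _ _ => mul_nonneg (w J).2 (hh k j)
          exact Finset.mem_Icc.2 ⟨(Finset.mem_filter.1 hj).2.1, R.le_max' j hj⟩
  refine (Finset.sum_le_sum fun k _ => row k).trans ?_
  rw [Finset.sum_add_distrib, Finset.sum_comm, Finset.mul_sum, ← Finset.sum_add_distrib]
  refine Finset.sum_le_sum fun j hj => ?_
  rw [← Finset.sum_mul]
  have h1 := mul_le_mul_of_nonneg_right (h_col j hj) (mul_nonneg hs (hτ0 j))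
  linarith

/-- Player `1` is offered the price `Q (v 0)` when `v 0 ∈ A`; if no sale takes place, player `0` is
offered the price `p` when `v 1 ∈ B`. -/
noncomputable def sequentialOffer (A B : Set ℝ≥0) (Q : ℝ≥0 → ℝ) (p : ℝ≥0) : Mechanism 2 :=
  open Classical in
  let alloc : (Fin 2 → ℝ≥0) → Option (Fin 2) := fun v =>
    if v 0 ∈ A ∧ Q (v 0) ≤ v 1 then some 1 else if v 1 ∈ B ∧ p ≤ v 0 then some 0 else none
  { alloc := alloc
    pay := fun v i => if alloc v = some i then ![(p : ℝ), Q (v 0)] i else 0 }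

open Classical in
theorem util_sequentialOffer_zero (A B : Set ℝ≥0) (Q : ℝ≥0 → ℝ) (p : ℝ≥0) (v : Fin 2 → ℝ≥0)
    (t : ℝ≥0) : (sequentialOffer A B Q p).util v 0 t =
      if ¬(v 0 ∈ A ∧ Q (v 0) ≤ v 1) ∧ v 1 ∈ B ∧ p ≤ v 0 then (t : ℝ) - p else 0 := by
  by_cases h1 : v 0 ∈ A ∧ Q (v 0) ≤ v 1 <;> by_cases h2 : v 1 ∈ B ∧ p ≤ v 0 <;>
    simp [sequentialOffer, util, h1, h2]

open Classical in
theorem util_sequentialOffer_one (A B : Set ℝ≥0) (Q : ℝ≥0 → ℝ) (p : ℝ≥0) (v : Fin 2 → ℝ≥0)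
    (t : ℝ≥0) : (sequentialOffer A B Q p).util v 1 t =
      if v 0 ∈ A ∧ Q (v 0) ≤ v 1 then (t : ℝ) - Q (v 0) else 0 := by
  by_cases h1 : v 0 ∈ A ∧ Q (v 0) ≤ v 1 <;> by_cases h2 : v 1 ∈ B ∧ p ≤ v 0 <;>
    simp [sequentialOffer, util, h1, h2]

/-- The sequential offer is `α`-moral if player `1`'s surplus always outweighs, by a factor `α`,
what player `0` could gain by taking the item from player `1`. -/
theorem sequentialOffer_moral {A B : Set ℝ≥0} {Q : ℝ≥0 → ℝ} {p : ℝ≥0} {α : ℝ}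
    (hQ : ∀ a, 0 ≤ Q a)
    (hAB : ∀ a ∈ A, ∀ b ∈ B, Q a ≤ b → (a : ℝ) - p ≤ α * (b - Q a)) :
    (sequentialOffer A B Q p).Moral α := by
  classical
  have erase0 : (univ : Finset (Fin 2)).erase 0 = {1} := by decide
  refine ⟨?_, ?_, ?_⟩
  · intro v i
    fin_cases i <;> by_cases h1 : v 0 ∈ A ∧ Q (v 0) ≤ v 1 <;>
      by_cases h2 : v 1 ∈ B ∧ p ≤ v 0 <;> simp [sequentialOffer, h1, h2]
  · intro v i
    fin_cases i <;> by_cases h1 : v 0 ∈ A ∧ Q (v 0) ≤ v 1 <;>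
      by_cases h2 : v 1 ∈ B ∧ p ≤ v 0 <;> simp [sequentialOffer, h1, h2, hQ]
  · intro v i r
    fin_cases i
    · simp only [Fin.zero_eta, erase0, Finset.sum_singleton, util_sequentialOffer_zero,
        util_sequentialOffer_one, Function.update_self,
        Function.update_of_ne (show (1 : Fin 2) ≠ 0 by decide)]
      intro hpos
      by_cases hv : v 0 ∈ A ∧ Q (v 0) ≤ v 1
      · have key := hAB _ hv.1 (v 1)
        by_cases hu : ¬(r ∈ A ∧ Q r ≤ v 1) ∧ v 1 ∈ B ∧ p ≤ r
        · simpa [hv, hu] using key hu.2.1 hv.2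
        · rw [if_neg hu] at hpos
          simp [hv] at hpos
      · by_cases hv' : v 1 ∈ B ∧ p ≤ v 0
        · simp only [hv, hv', not_false_eq_true, and_self, if_true] at hpos
          have : (p : ℝ) ≤ v 0 := by exact_mod_cast hv'.2
          split_ifs at hpos <;> linarith
        · simp only [hv, hv', and_false, if_false, sub_zero] at hpos
          split_ifs at hpos with hu
          · have : p ≤ v 0 := by
              rw [← NNReal.coe_le_coe]; linarith
            exact absurd ⟨hu.2.1, this⟩ hv'
          · exact absurd hpos (lt_irrefl _)
    · simp only [Fin.mk_one, util_sequentialOffer_one, Function.update_self,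
        Function.update_of_ne (show (0 : Fin 2) ≠ 1 by decide)]
      intro hpos
      split_ifs at hpos with h1 h2 h2
      · linarith
      · exact absurd ⟨h1.1, by linarith⟩ h2
      · linarith
      · linarith

end Mechanism

namespace RevenueGap

/-- Total revenue weight of row `k`: the value `s / (1 - ρ ^ (k + 1))` of player `1` occurs with
probability `rowWeight k * (1 - ρ ^ (k + 1))` in this row. Here `d = ρ⁻¹`. -/
noncomputable def rowWeight (C d ρ : ℝ) (k : ℕ) : ℝ :=
  C * d ^ (k + 1) * if k = 0 then 1 else 1 - ρ

/-- Probability of the `k`-th value of player `0` together with the `j`-th value of player `1`. -/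
noncomputable def weight (C d ρ : ℝ) (k j : ℕ) : ℝ :=
  if j = k then rowWeight C d ρ k * (1 - ρ ^ (k + 1))
  else if k < j then rowWeight C d ρ k * (ρ ^ j * (1 - ρ)) else 0

variable {C d ρ : ℝ}

theorem rowWeight_nonneg (hC : 0 ≤ C) (hd : 0 ≤ d) (hρ1 : ρ ≤ 1) (k : ℕ) :
    0 ≤ rowWeight C d ρ k := by
  unfold rowWeight
  have : 0 ≤ 1 - ρ := sub_nonneg.2 hρ1
  split_ifs <;> positivity

theorem weight_nonneg (hC : 0 ≤ C) (hd : 0 ≤ d) (hρ0 : 0 ≤ ρ) (hρ1 : ρ ≤ 1) (k j : ℕ) :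
    0 ≤ weight C d ρ k j := by
  have h1 := rowWeight_nonneg hC hd hρ1 k
  have h2 : 0 ≤ 1 - ρ := sub_nonneg.2 hρ1
  have h3 : 0 ≤ 1 - ρ ^ (k + 1) := sub_nonneg.2 (pow_le_one₀ hρ0 hρ1)
  unfold weight
  split_ifs <;> positivity

theorem weight_of_lt {k j : ℕ} (h : j < k) : weight C d ρ k j = 0 := by
  simp [weight, h.ne, h.not_gt]

theorem weight_of_gt {k j : ℕ} (h : k < j) :
    weight C d ρ k j = rowWeight C d ρ k * (ρ ^ j * (1 - ρ)) := by
  simp [weight, h.ne', h]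

theorem weight_self (k : ℕ) :
    weight C d ρ k k = rowWeight C d ρ k * (1 - ρ ^ (k + 1)) := by
  simp [weight]

theorem sum_rowWeight (hdρ : d * ρ = 1) (n : ℕ) :
    ∑ k ∈ range (n + 1), rowWeight C d ρ k = C * d ^ (n + 1) := by
  induction n with
  | zero => simp [rowWeight]
  | succ n ih =>
    rw [Finset.sum_range_succ, ih]
    simp only [rowWeight, Nat.succ_ne_zero, if_false]
    linear_combination (-C * d ^ (n + 1)) * hdρ

theorem sum_rowWeight_mul_pow (hdρ : d * ρ = 1) (n : ℕ) :
    ∑ k ∈ range (n + 1), rowWeight C d ρ k * ρ ^ (k + 1) = C + n * C * (1 - ρ) := by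
  have hpow : ∀ k, d ^ k * ρ ^ k = 1 := fun k => by rw [← mul_pow, hdρ, one_pow]
  induction n with
  | zero => simp [rowWeight, mul_assoc, hdρ]
  | succ n ih =>
    rw [Finset.sum_range_succ, ih]
    simp only [rowWeight, Nat.succ_ne_zero, if_false]
    push_cast
    linear_combination (C * (1 - ρ)) * hpow (n + 1 + 1)

theorem sum_Icc_weight {k J : ℕ} (h : k ≤ J) :
    ∑ j ∈ Icc k J, weight C d ρ k j = rowWeight C d ρ k * (1 - ρ ^ (J + 1)) := by
  induction J, h using Nat.le_induction with
  | base => simp [weight_self]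
  | succ J hJ ih =>
    rw [Finset.sum_Icc_succ_top (by omega), ih, weight_of_gt (by omega)]
    ring

theorem sum_row_weight {k n : ℕ} (h : k ≤ n) :
    ∑ j ∈ range (n + 1), weight C d ρ k j = rowWeight C d ρ k * (1 - ρ ^ (n + 1)) := by
  rw [← sum_Icc_weight h]
  symm
  refine Finset.sum_subset (fun j hj => ?_) fun j hj hj' => weight_of_lt ?_
  · simp only [Finset.mem_Icc, Finset.mem_range] at *
    omega
  · simp only [Finset.mem_Icc, Finset.mem_range] at *
    omega

theorem sum_col_weight_le (hC : 0 ≤ C) (hd : 0 ≤ d) (hρ0 : 0 ≤ ρ) (hρ1 : ρ ≤ 1) (hdρ : d * ρ = 1)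
    {j N : ℕ} (h : j ∈ range N) :
    ∑ k ∈ range N, weight C d ρ k j ≤ rowWeight C d ρ j := by
  have hpow : ∀ k, d ^ k * ρ ^ k = 1 := fun k => by rw [← mul_pow, hdρ, one_pow]
  have hsub : ∑ k ∈ range (j + 1), weight C d ρ k j = ∑ k ∈ range N, weight C d ρ k j := by
    refine Finset.sum_subset (fun k hk => ?_) fun k _ hk => weight_of_lt ?_
    · simp only [Finset.mem_range] at *
      omega
    · simp only [Finset.mem_range] at *
      omega
  rw [← hsub, Finset.sum_range_succ, weight_self,
    Finset.sum_congr rfl fun k hk => weight_of_gt (Finset.mem_range.1 hk), ← Finset.sum_mul]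
  cases j with
  | zero =>
    have := mul_nonneg (rowWeight_nonneg hC hd hρ1 0) hρ0
    simp only [Finset.range_zero, Finset.sum_empty, zero_mul, zero_add, pow_one]
    linarith
  | succ j =>
    rw [sum_rowWeight hdρ]
    simp only [rowWeight, Nat.succ_ne_zero, if_false]
    refine le_of_eq ?_
    linear_combination (C * (1 - ρ)) * hpow (j + 1) - (C * (1 - ρ)) * hpow (j + 1 + 1)

theorem exists_instance {α s σ : ℝ} {n : ℕ} (hα0 : 0 < α) (hα1 : α ≤ 1) (hs : 1 ≤ s) (hσ0 : 0 < σ)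
    (hC : 0 ≤ C) (hd : 0 ≤ d) (hρ0 : 0 < ρ) (hρ1 : ρ < 1) (hdρ : d * ρ = 1)
    (hσ : σ < ρ ^ (n + 1) * (1 - ρ)) (hmass : C * d ^ (n + 1) = 1 + C) :
    ∃ (S : Finset (Fin 2 → ℝ≥0)) (H : (Fin 2 → ℝ≥0) → ℝ),
      (∀ v, 0 ≤ H v) ∧ (∀ v, v ∉ S → H v = 0) ∧ (∑ v ∈ S, H v = 1) ∧
      (∃ M : Mechanism 2, M.Moral α ∧
        s - σ + s * (C + n * C * (1 - ρ)) ≤ ∑ v ∈ S, H v * ∑ i, M.pay v i) ∧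
      (∀ M : Mechanism 2, M.IR → M.NPT → M.DominantStrategy →
        ∑ v ∈ S, H v * ∑ i, M.pay v i ≤ s * (1 + C)) := by
  classical
  have hpow_lt : ∀ k : ℕ, ρ ^ (k + 1) < 1 := fun k => pow_lt_one₀ hρ0.le hρ1 (by omega)
  have hden : ∀ k : ℕ, 0 < 1 - ρ ^ (k + 1) := fun k => sub_pos.2 (hpow_lt k)
  have hσ1 : σ < 1 := by nlinarith [hpow_lt n, pow_pos hρ0 (n + 1)]
  have hασ : α * σ ≤ σ := by nlinarith
  have hασ0 : 0 < α * σ := by positivity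
  have hfrac : ∀ k : ℕ, 0 < α * σ / (k + 1) ∧ α * σ / (k + 1) ≤ α * σ := fun k =>
    ⟨by positivity, div_le_self hασ0.le (by linarith [k.cast_nonneg (α := ℝ)])⟩
  obtain ⟨x, hx⟩ : ∃ x : ℕ → ℝ≥0, ∀ k, (x k : ℝ) = s - α * σ / (k + 1) :=
    ⟨fun k => ⟨s - α * σ / (k + 1), by linarith [hfrac k]⟩, fun _ => rfl⟩
  obtain ⟨w, hw⟩ : ∃ w : ℕ → ℝ≥0, ∀ k, (w k : ℝ) = s / (1 - ρ ^ (k + 1)) :=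
    ⟨fun k => ⟨s / (1 - ρ ^ (k + 1)), div_nonneg (by linarith) (hden k).le⟩, fun _ => rfl⟩
  have hx_mono : StrictMono x := by
    refine strictMono_nat_of_lt_succ fun k => ?_
    rw [← NNReal.coe_lt_coe, hx, hx]
    push_cast
    gcongr
    linarith
  have hw_mul : ∀ k, (w k : ℝ) * (1 - ρ ^ (k + 1)) = s := fun k => by
    rw [hw, div_mul_cancel₀ _ (hden k).ne']
  have hw_anti : StrictAnti w := by
    refine strictAnti_nat_of_succ_lt fun k => ?_
    rw [← NNReal.coe_lt_coe, hw, hw]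
    have : ρ ^ (k + 1 + 1) < ρ ^ (k + 1) := pow_lt_pow_right_of_lt_one₀ hρ0 hρ1 (by omega)
    exact div_lt_div_of_pos_left (by linarith) (hden k) (by linarith)
  have hsw : ∀ k, s ≤ w k := fun k => by
    rw [hw, le_div_iff₀ (hden k)]
    nlinarith [pow_pos hρ0 (k + 1)]
  have hgap : ∀ k ≤ n, (w (k + 1) : ℝ) < w k - σ := by
    intro k hk
    have h1 := hw_mul k
    have h2 := hw_mul (k + 1)
    have h3 : ρ ^ (n + 1) ≤ ρ ^ (k + 1) := pow_le_pow_of_le_one hρ0.le hρ1.le (by omega)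
    have h4 : σ < ρ ^ (k + 1) * (1 - ρ) := hσ.trans_le (by gcongr)
    have h5 : (w (k + 1) : ℝ) < w k := by exact_mod_cast hw_anti k.lt_succ_self
    have h6 : 0 < ρ ^ (k + 1 + 1) := by positivity
    have h7 : ((w k : ℝ) - w (k + 1)) * (1 - ρ ^ (k + 1 + 1)) =
        w k * (ρ ^ (k + 1) * (1 - ρ)) := by
      linear_combination h1 - h2
    nlinarith [hsw k]
  let P : Finset (ℕ × ℕ) := range (n + 1) ×ˢ range (n + 1)
  let pt : ℕ × ℕ → Fin 2 → ℝ≥0 := fun i => ![x i.1, w i.2]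
  have hpush := sum_image_pushforward P pt fun i => weight C d ρ i.1 i.2
  refine ⟨P.image pt, fun v => ∑ i ∈ P, if pt i = v then weight C d ρ i.1 i.2 else 0,
    fun v => ?_, fun v hv => ?_, ?_, ?_, fun M hIR hNPT hDS => ?_⟩
  · refine Finset.sum_nonneg fun i _ => ?_
    split_ifs
    · exact weight_nonneg hC hd hρ0.le hρ1.le _ _
    · exact le_rfl
  · refine Finset.sum_eq_zero fun i hi => if_neg fun h => hv ?_
    exact h ▸ Finset.mem_image_of_mem pt hi
  · have h1 := hpush fun _ => 1
    simp only [mul_one] at h1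
    rw [h1, Finset.sum_product,
      Finset.sum_congr rfl fun k hk => sum_row_weight (Finset.mem_range_succ_iff.1 hk),
      ← Finset.sum_mul, sum_rowWeight hdρ, mul_sub, mul_one, mul_assoc, ← mul_pow, hdρ, hmass]
    simp
  · let Q : ℝ≥0 → ℝ := Function.extend x (fun k => (w k : ℝ) - σ) 0
    have hQ : ∀ k, Q (x k) = w k - σ := fun k => hx_mono.injective.extend_apply _ _ k
    have hQ0 : ∀ a, 0 ≤ Q a := by
      intro a
      by_cases ha : ∃ k, x k = a
      · obtain ⟨k, rfl⟩ := ha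
        rw [hQ]
        linarith [hsw k]
      · simp [Q, Function.extend_apply' _ _ _ ha]
    refine ⟨Mechanism.sequentialOffer (x '' Set.Iic n) (Set.range w) Q (x 0),
      Mechanism.sequentialOffer_moral hQ0 ?_, ?_⟩
    · rintro _ ⟨k, hk, rfl⟩ _ ⟨j, rfl⟩ hle
      rw [hQ] at hle ⊢
      have hjk : j ≤ k := by
        by_contra! hkj
        have h1 : (w j : ℝ) ≤ w (k + 1) := by exact_mod_cast hw_anti.antitone hkj
        linarith [hgap k hk]
      have h1 : (w k : ℝ) ≤ w j := by exact_mod_cast hw_anti.antitone hjk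
      have h2 : α * σ ≤ α * (w j - (w k - σ)) := by gcongr; linarith
      have h3 : (x 0 : ℝ) = s - α * σ := by simp [hx]
      rw [h3, hx]
      linarith [hfrac k]
    · rw [hpush, Finset.sum_product]
      have hcell : ∀ k ≤ n, ∀ j, k ≤ j → (if j = k then (w k : ℝ) - s else 0) + (s - σ) ≤
          ∑ i, (Mechanism.sequentialOffer (x '' Set.Iic n) (Set.range w) Q (x 0)).pay
            ![x k, w j] i := by
        intro k hk j hkj
        have hxk : ∃ i ≤ n, x i = x k := ⟨k, hk, rfl⟩
        have h0 : x 0 ≤ x k := hx_mono.monotone (Nat.zero_le k)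
        have h3 : (x 0 : ℝ) = s - α * σ := by simp [hx]
        by_cases hwin : (w k : ℝ) - σ ≤ w j
        · simp [Mechanism.sequentialOffer, hxk, hQ, hwin]
          split_ifs <;> linarith [hsw k]
        · have hne : j ≠ k := by
            rintro rfl
            exact hwin (by linarith)
          simp [Mechanism.sequentialOffer, hQ, hwin, h0, hne]
          linarith
      have hrow : ∀ k ∈ range (n + 1), rowWeight C d ρ k * (1 - ρ ^ (n + 1)) * (s - σ) +
          s * (rowWeight C d ρ k * ρ ^ (k + 1)) ≤ ∑ j ∈ range (n + 1), weight C d ρ k j *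
          ∑ i, (Mechanism.sequentialOffer (x '' Set.Iic n) (Set.range w) Q (x 0)).pay
            ![x k, w j] i := by
        intro k hk
        have hkn := Finset.mem_range_succ_iff.1 hk
        refine le_trans (le_of_eq ?_) (Finset.sum_le_sum
          (f := fun j => weight C d ρ k j * ((if j = k then (w k : ℝ) - s else 0) + (s - σ)))
          fun j _ => ?_)
        swap
        · rcases lt_or_ge j k with hjk | hkj
          · simp [weight_of_lt hjk]
          · exact mul_le_mul_of_nonneg_left (hcell k hkn j hkj)
              (weight_nonneg hC hd hρ0.le hρ1.le k j)
        simp only [mul_add, Finset.sum_add_distrib, mul_ite, mul_zero, Finset.sum_ite_eq', hk,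
          if_true]
        rw [← Finset.sum_mul, sum_row_weight hkn, weight_self]
        linear_combination (-rowWeight C d ρ k) * hw_mul k
      refine le_trans (le_of_eq ?_) (Finset.sum_le_sum hrow)
      rw [Finset.sum_add_distrib, ← Finset.sum_mul, ← Finset.sum_mul, ← Finset.mul_sum,
        sum_rowWeight hdρ, sum_rowWeight_mul_pow hdρ]
      have hpow : d ^ (n + 1) * ρ ^ (n + 1) = 1 := by rw [← mul_pow, hdρ, one_pow]
      linear_combination (C * (s - σ)) * hpow - (s - σ) * hmass
  · rw [hpush, Finset.sum_product, ← hmass, ← sum_rowWeight hdρ]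
    refine hDS.revenue_le hIR hNPT hx_mono hw_anti (fun k => ?_)
      (weight_nonneg hC hd hρ0.le hρ1.le) (fun _ _ => weight_of_lt)
      (rowWeight_nonneg hC hd hρ1.le) (fun k J hkJ => ?_)
      fun j hj => sum_col_weight_le hC hd hρ0.le hρ1.le hdρ hj
    · rw [hx]
      linarith [hfrac k]
    · rw [sum_Icc_weight hkJ, ← hw_mul J]
      exact le_of_eq (by ring)

end RevenueGap

theorem stmt11 (α : ℝ) (hα0 : 0 < α) (hα1 : α ≤ 1) :
    ∃ ε₀ > (0 : ℝ), ∃ δ₀ > (0 : ℝ), ∀ ε δ : ℝ, 0 < ε → ε ≤ ε₀ → 0 < δ → δ ≤ δ₀ →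
      ∃ (S : Finset (Fin 2 → ℝ≥0)) (H : (Fin 2 → ℝ≥0) → ℝ),
        (∀ v, 0 ≤ H v) ∧ (∀ v, v ∉ S → H v = 0) ∧ (∑ v ∈ S, H v = 1) ∧
        (∃ M : Mechanism 2, M.Moral α ∧
          Real.exp 1 / (Real.exp 1 - 1) + δ + 1 / (Real.exp 1 - 1) -
              ((Real.exp 1 + 1) / (Real.exp 1 - 1)) * ε - ε * δ ≤
            ∑ v ∈ S, H v * ∑ i, M.pay v i) ∧
        (∀ M : Mechanism 2, M.IR → M.NPT → M.DominantStrategy →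
          ∑ v ∈ S, H v * ∑ i, M.pay v i ≤ Real.exp 1 / (Real.exp 1 - 1) + δ) := by
  refine ⟨1, one_pos, 1, one_pos, fun ε δ hε0 _ hδ0 _ => ?_⟩
  have he : 2 < Real.exp 1 := by linarith [Real.exp_one_gt_d9]
  obtain ⟨n, hn⟩ := exists_nat_gt (2 / ε)
  have hn0 : (0 : ℝ) ≤ n := n.cast_nonneg
  set y : ℝ := 1 / (n + 1) with hy
  have hy0 : 0 < y := by positivity
  have hρ1 : Real.exp (-y) < 1 := by simpa using hy0
  have hdρ : Real.exp y * Real.exp (-y) = 1 := by rw [← Real.exp_add]; simp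
  have hd_pow : Real.exp y ^ (n + 1) = Real.exp 1 := by
    rw [← Real.exp_nat_mul, hy]
    congr 1
    push_cast
    field_simp
  have hρ_gap : 1 - ε ≤ n * (1 - Real.exp (-y)) := by
    have h1 : Real.exp (-y) * (1 + y) ≤ 1 := by
      rw [← hdρ, mul_comm]
      exact mul_le_mul_of_nonneg_right (by linarith [Real.add_one_le_exp y]) (Real.exp_pos _).le
    have h2 : Real.exp (-y) * (n + 2) ≤ n + 1 := by
      have h3 : y * (n + 1) = 1 := by rw [hy]; field_simp
      nlinarith
    have h4 : 2 < n * ε := (div_lt_iff₀ hε0).1 hn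
    have h5 : (1 - ε) * (n + 2) ≤ n := by nlinarith
    have h6 : n * Real.exp (-y) * (n + 2) ≤ n * (n + 1) := by nlinarith
    nlinarith
  have hb : 0 < Real.exp (-y) ^ (n + 1) * (1 - Real.exp (-y)) :=
    mul_pos (by positivity) (by linarith)
  obtain ⟨σ, hσ0, hσ⟩ := exists_between (lt_min hε0 hb)
  obtain ⟨S, H, h1, h2, h3, ⟨M, hM, hrev⟩, h5⟩ := RevenueGap.exists_instance
    (s := 1 + δ * (Real.exp 1 - 1) / Real.exp 1) (C := 1 / (Real.exp 1 - 1)) (d := Real.exp y)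
    hα0 hα1 (le_add_of_nonneg_right (div_nonneg (mul_nonneg hδ0.le (by linarith)) (by linarith)))
    hσ0 (div_nonneg zero_le_one (by linarith)) (Real.exp_pos _).le (Real.exp_pos _) hρ1 hdρ
    (hσ.trans_le (min_le_right _ _))
    (by rw [hd_pow]; field_simp [show Real.exp 1 - 1 ≠ 0 by linarith]; ring)
  have hs : (1 + δ * (Real.exp 1 - 1) / Real.exp 1) * (1 + 1 / (Real.exp 1 - 1)) =
      Real.exp 1 / (Real.exp 1 - 1) + δ := by
    field_simp [show Real.exp 1 - 1 ≠ 0 by linarith]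
    ring
  refine ⟨S, H, h1, h2, h3, ⟨M, hM, le_trans ?_ hrev⟩, fun M' hIR hNPT hDS =>
    (h5 M' hIR hNPT hDS).trans hs.le⟩
  have hσε := hσ.trans_le (min_le_left _ _)
  have hC : 0 < 1 / (Real.exp 1 - 1) := by
    have : 0 < Real.exp 1 - 1 := by linarith
    positivity
  have hfrac : (Real.exp 1 + 1) / (Real.exp 1 - 1) = 1 + 2 * (1 / (Real.exp 1 - 1)) := by
    field_simp [show Real.exp 1 - 1 ≠ 0 by linarith]
    ring
  have hs1 : 0 ≤ δ * (Real.exp 1 - 1) / Real.exp 1 :=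
    div_nonneg (mul_nonneg hδ0.le (by linarith)) (by linarith)
  rw [hfrac, ← hs]
  set C := 1 / (Real.exp 1 - 1)
  set t := δ * (Real.exp 1 - 1) / Real.exp 1
  have hg0 : 0 ≤ C * (n * (1 - Real.exp (-y))) :=
    mul_nonneg hC.le (mul_nonneg hn0 (by linarith))
  have hg1 : C * (1 - ε) ≤ C * (n * (1 - Real.exp (-y))) :=
    mul_le_mul_of_nonneg_left hρ_gap hC.le
  have hg2 := mul_nonneg hs1 hg0
  have hεδ := mul_pos hε0 hδ0
  have hCε := mul_pos hC hε0
  linarith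
end

section
/- Let F be a standard discrete distribution on V = {0, ε, …, 1} with monopolist price x, with n players' values drawn i.i.d. from F. Fix a revenue-maximizing moral mechanism M (a profit maximizer) with potential payment functions p_{-1},…,p_{-n}. Suppose that for some player i and some v_{-i} ∈ V^{n−1} with max(v_{-i}) ≥ x it holds that for every player j and every v̂_{-j} ≻ v_{-i}, p_{-j}(v̂_{-j}) ≥ max(v̂_{-j}). Then there exists a moral mechanism M' with potential payment functions p'_{-1},…,p'_{-n} such that p'_{-j}(v̂_{-j}) ≥ max(v̂_{-j}) for every v̂_{-j} ≻ v_{-i}, p'_{-i}(v_{-i}) ≥ max(v_{-i}), and the expected revenue of M' is not lower than the expected revenue of M. -/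
open scoped NNReal ENNReal
open Finset

/-- A moral mechanism, in its equivalent description as a profit maximizer: an individually
rational, payment independent single-item mechanism with no positive transfers, described by
its potential payment functions `pp i` (the payment of player `i` if he wins, given the
others' values; `⊤` if he can never win) together with an allocation rule that gives the item
to a player with maximal nonnegative potential profit `vᵢ − pp i v`, and allocates whenever
some player has strictly positive potential profit. -/
structure PM (n : ℕ) where
  pp : Fin n → (Fin n → ℝ≥0) → ℝ≥0∞
  alloc : (Fin n → ℝ≥0) → Option (Fin n)
  indep : ∀ (i : Fin n) (v : Fin n → ℝ≥0) (r : ℝ≥0),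
    pp i (Function.update v i r) = pp i v
  ir : ∀ (v : Fin n → ℝ≥0) (i : Fin n), alloc v = some i → pp i v ≤ (v i : ℝ≥0∞)
  maxProfit : ∀ (v : Fin n → ℝ≥0) (i : Fin n), alloc v = some i →
    ∀ j : Fin n, (v j : ℝ≥0∞) + pp i v ≤ (v i : ℝ≥0∞) + pp j v
  sells : ∀ v : Fin n → ℝ≥0, (∃ i, pp i v < (v i : ℝ≥0∞)) → alloc v ≠ none

namespace PM

variable {n : ℕ}

/-- The revenue of a profit maximizer in a given instance: the winner pays his potential
payment, and the revenue is `0` if the item is unallocated. -/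
noncomputable def rev (M : PM n) (v : Fin n → ℝ≥0) : ℝ :=
  match M.alloc v with
  | some i => (M.pp i v).toReal
  | none => 0

/-- Expected revenue when the `n` values are drawn i.i.d. from the discrete distribution
with pdf `g` on the grid `{0, ε, 2ε, …, mε}`. -/
noncomputable def expRev (m : ℕ) (ε : ℝ≥0) (g : ℕ → ℝ) (M : PM n) : ℝ :=
  ∑ k : Fin n → Fin (m + 1),
    (∏ i, g ((k i : ℕ))) * M.rev (fun i => ((k i : ℕ) : ℝ≥0) * ε)

/-- `M` maximizes expected revenue among all moral mechanisms (profit maximizers). -/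
def RevMax (m : ℕ) (ε : ℝ≥0) (g : ℕ → ℝ) (M : PM n) : Prop :=
  ∀ M' : PM n, expRev m ε g M' ≤ expRev m ε g M

/-- All coordinates of `v` belong to the grid `{0, ε, 2ε, …, mε}`. -/
def OnGrid (m : ℕ) (ε : ℝ≥0) (v : Fin n → ℝ≥0) : Prop :=
  ∀ i, ∃ k ≤ m, v i = (k : ℝ≥0) * ε

/-- `max(v₋ᵢ)` : the largest entry of `v` outside coordinate `i`. -/
noncomputable def maxOther (i : Fin n) (v : Fin n → ℝ≥0) : ℝ≥0 :=
  (Finset.univ.erase i).sup v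

/-- The entries of `v` outside coordinate `i`, sorted in decreasing order. -/
noncomputable def sortedDel (i : Fin n) (v : Fin n → ℝ≥0) : List ℝ≥0 :=
  List.insertionSort (· ≥ ·) ((List.ofFn v).eraseIdx (i : ℕ))

/-- `w₋ⱼ ≻ v₋ᵢ` : the decreasingly sorted entries of `w` outside `j` are lexicographically
greater than the decreasingly sorted entries of `v` outside `i`. -/
def SuccOrd (j : Fin n) (w : Fin n → ℝ≥0) (i : Fin n) (v : Fin n → ℝ≥0) : Prop :=
  List.Lex (· < ·) (sortedDel i v) (sortedDel j w)

/-- `x` is (the index of) the monopolist price of the distribution with pdf `g` on the grid: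
`x·ε` maximizes `p·(1 − F(p − ε))` over grid prices `p`. -/
def MonopolistIdx (m : ℕ) (ε : ℝ≥0) (g : ℕ → ℝ) (x : ℕ) : Prop :=
  x ≤ m ∧ ∀ k ≤ m,
    (k : ℝ) * (ε : ℝ) * (1 - ∑ j ∈ Finset.range k, g j) ≤
      (x : ℝ) * (ε : ℝ) * (1 - ∑ j ∈ Finset.range x, g j)

/-- The distribution with pdf `g` on the grid `{0, ε, …, mε}` is standard. -/
def StandardD (m : ℕ) (ε : ℝ≥0) (g : ℕ → ℝ) : Prop :=
  ∀ k k' : ℕ, k ≤ m → k' < k →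
    (k' : ℝ) * (ε : ℝ) - (ε : ℝ) * (1 - ∑ j ∈ Finset.range (k + 1), g j) / g k' ≤
      (k : ℝ) * (ε : ℝ) - (ε : ℝ) * (1 - ∑ j ∈ Finset.range (k + 1), g j) / g k

end PM

/-- Inserting a larger element into a decreasingly sorted list gives a lexicographically
larger list. -/
theorem List.lex_orderedInsert_of_lt {α : Type*} [LinearOrder α] {a b : α} (hab : a < b)
    (l : List α) (hl : l.Pairwise (· ≥ ·)) :
    List.Lex (· < ·) (List.orderedInsert (· ≥ ·) a l) (List.orderedInsert (· ≥ ·) b l) := by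
  induction l generalizing b with
  | nil => exact List.Lex.rel hab
  | cons c l ih =>
    have hl' := List.pairwise_cons.1 hl
    by_cases hac : a ≥ c
    · rw [List.orderedInsert_cons_of_le (· ≥ ·) l hac, List.orderedInsert_cons_of_le (· ≥ ·) l
        (show b ≥ c from hac.trans hab.le)]
      exact List.Lex.rel hab
    · have hac' : a < c := not_le.1 hac
      rw [List.orderedInsert_of_not_le (· ≥ ·) l hac]
      by_cases hbc : b ≥ c
      · rw [List.orderedInsert_cons_of_le (· ≥ ·) l hbc]
        rcases hbc.lt_or_eq with h | h
        · exact List.Lex.rel h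
        · subst h
          refine List.Lex.cons ?_
          have := ih hac' hl'.2
          cases l with
          | nil => exact this
          | cons d l => rwa [List.orderedInsert_cons_of_le (· ≥ ·) (a := c) l
              (hl'.1 d List.mem_cons_self)] at this
      · rw [List.orderedInsert_of_not_le (· ≥ ·) l hbc]
        exact List.Lex.cons (ih hab hl'.2)

namespace PM

variable {n : ℕ}

theorem coe_sortedDel (i : Fin n) (v : Fin n → ℝ≥0) :
    (sortedDel i v : Multiset ℝ≥0) = (univ.erase i).val.map v := by
  have h1 : (sortedDel i v : Multiset ℝ≥0) = ((List.ofFn v).eraseIdx (i : ℕ) : List ℝ≥0) :=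
    Multiset.coe_eq_coe.2 (List.perm_insertionSort _ _)
  have h2 := Multiset.coe_eq_coe.2
    (List.getElem_cons_eraseIdx_perm (l := List.ofFn v) (n := i) (by simp))
  have h3 : ((List.ofFn v : List ℝ≥0) : Multiset ℝ≥0) = univ.val.map v := by
    rw [Fin.univ_val_map]
  rw [h1]
  rw [h3, ← Multiset.cons_coe, ← Finset.insert_erase (mem_univ i),
    Finset.insert_val_of_notMem (Finset.notMem_erase i univ), Multiset.map_cons] at h2
  rw [List.getElem_ofFn] at h2
  exact (Multiset.cons_inj_right _).1 h2

theorem sortedDel_eq_insertionSort {i : Fin n} {v : Fin n → ℝ≥0} {l : List ℝ≥0}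
    (h : (univ.erase i).val.map v = (l : Multiset ℝ≥0)) :
    sortedDel i v = l.insertionSort (· ≥ ·) := by
  refine List.Perm.eq_of_pairwise' (r := (· ≥ ·)) (List.pairwise_insertionSort _ _)
    (List.pairwise_insertionSort _ _) ?_
  refine Multiset.coe_eq_coe.1 ?_
  rw [coe_sortedDel, h]
  exact (Multiset.coe_eq_coe.2 (List.perm_insertionSort _ _)).symm

theorem sortedDel_congr {i : Fin n} {v w : Fin n → ℝ≥0} (h : ∀ k, k ≠ i → w k = v k) :
    sortedDel i w = sortedDel i v := by
  have : (univ.erase i).val.map w = (sortedDel i v : Multiset ℝ≥0) := by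
    rw [coe_sortedDel]
    exact Multiset.map_congr rfl fun k hk => h k (Finset.ne_of_mem_erase (s := univ) hk)
  rw [sortedDel_eq_insertionSort this]
  exact List.Perm.eq_of_pairwise' (r := (· ≥ ·)) (List.pairwise_insertionSort _ _)
    (List.pairwise_insertionSort _ _) (List.perm_insertionSort _ _)

theorem map_erase_eq_cons {i k : Fin n} (hik : i ≠ k) (w : Fin n → ℝ≥0) :
    (univ.erase k).val.map w = w i ::ₘ ((univ.erase k).erase i).val.map w := by
  conv_lhs => rw [← Finset.insert_erase (Finset.mem_erase.2 ⟨hik, mem_univ i⟩),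
    Finset.insert_val_of_notMem (Finset.notMem_erase i _), Multiset.map_cons]

theorem succOrd_of_lt {i k : Fin n} (hik : i ≠ k) {v w : Fin n → ℝ≥0}
    (hvw : ∀ l, l ≠ i → l ≠ k → w l = v l) (h : v k < w i) : SuccOrd k w i v := by
  obtain ⟨l, hl⟩ := Quot.exists_rep (((univ.erase i).erase k).val.map v)
  have hl : (l : Multiset ℝ≥0) = ((univ.erase i).erase k).val.map v := hl
  have hv : (univ.erase i).val.map v = ((v k :: l : List ℝ≥0) : Multiset ℝ≥0) := by
    rw [map_erase_eq_cons hik.symm, ← hl, Multiset.cons_coe]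
  have hw : (univ.erase k).val.map w = ((w i :: l : List ℝ≥0) : Multiset ℝ≥0) := by
    rw [map_erase_eq_cons hik, ← Multiset.cons_coe, hl, Finset.erase_right_comm]
    congr 1
    refine Multiset.map_congr rfl fun a ha => ?_
    have ha : a ∈ (univ.erase i).erase k := ha
    exact hvw a (by grind) (by grind)
  rw [SuccOrd, sortedDel_eq_insertionSort hv, sortedDel_eq_insertionSort hw]
  exact List.lex_orderedInsert_of_lt h _ (List.pairwise_insertionSort _ _)

theorem succOrd_of_maxOther_lt {i k j : Fin n} {v w : Fin n → ℝ≥0} (hjk : j ≠ k)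
    (h : maxOther i v < w j) : SuccOrd k w i v := by
  have hmem : w j ∈ sortedDel k w := by
    rw [← Multiset.mem_coe, coe_sortedDel]
    exact Multiset.mem_map_of_mem _ (Finset.mem_erase.2 ⟨hjk, mem_univ j⟩)
  have hle : ∀ a ∈ sortedDel i v, a ≤ maxOther i v := by
    intro a ha
    rw [← Multiset.mem_coe, coe_sortedDel] at ha
    obtain ⟨l, hl, rfl⟩ := Multiset.mem_map.1 ha
    exact Finset.le_sup (f := v) hl
  have hs : (sortedDel k w).Pairwise (· ≥ ·) := List.pairwise_insertionSort _ _
  rw [SuccOrd]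
  cases hw : sortedDel k w with
  | nil => simp [hw] at hmem
  | cons c l =>
    cases hv : sortedDel i v with
    | nil => exact List.Lex.nil
    | cons d l' =>
      refine List.Lex.rel ?_
      have hd : d ≤ maxOther i v := hle d (by simp [hv])
      rw [hw] at hs hmem
      have hc : w j ≤ c := by
        rcases List.mem_cons.1 hmem with h | h
        · exact h.le
        · exact (List.pairwise_cons.1 hs).1 _ h
      exact hd.trans_lt (h.trans_le hc)

theorem succOrd_asymm {i k : Fin n} {v w : Fin n → ℝ≥0} (h : SuccOrd k w i v) :
    ¬ SuccOrd i v k w :=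
  fun h' => Std.Asymm.asymm (r := List.Lex ((· < ·) : ℝ≥0 → ℝ≥0 → Prop)) _ _ h h'

end PM

namespace PM

variable {n : ℕ}

/-- The payment collected when the outcome is `o` and the potential payments are `p`. -/
noncomputable def payment (p : Fin n → ℝ≥0∞) (o : Option (Fin n)) : ℝ :=
  match o with
  | some i => (p i).toReal
  | none => 0

/-- `o` is a profit-maximizing outcome at potential payments `p` and values `w`. -/
def IsValid (p : Fin n → ℝ≥0∞) (w : Fin n → ℝ≥0) (o : Option (Fin n)) : Prop :=
  (∀ i, o = some i → p i ≤ (w i : ℝ≥0∞) ∧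
    ∀ j, (w j : ℝ≥0∞) + p i ≤ (w i : ℝ≥0∞) + p j) ∧
  ((∃ i, p i < (w i : ℝ≥0∞)) → o ≠ none)

theorem isValid_some {p : Fin n → ℝ≥0∞} {w : Fin n → ℝ≥0} {i : Fin n}
    (h : p i ≤ (w i : ℝ≥0∞)) (h' : ∀ j, j ≠ i → (w j : ℝ≥0∞) + p i ≤ (w i : ℝ≥0∞) + p j) :
    IsValid p w (some i) := by
  refine ⟨fun k hk => ?_, fun _ => by simp⟩
  obtain rfl : i = k := by simpa using hk
  refine ⟨h, fun j => ?_⟩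
  by_cases hj : j = i
  · rw [hj]
  · exact h' j hj

theorem exists_isValid_some {p : Fin n → ℝ≥0∞} {w : Fin n → ℝ≥0}
    (h : ∃ l, p l ≤ (w l : ℝ≥0∞)) : ∃ l, IsValid p w (some l) := by
  classical
  obtain ⟨l, hl⟩ := h
  obtain ⟨k, hk, hmax⟩ := Finset.exists_max_image
    (univ.filter fun l => p l ≤ (w l : ℝ≥0∞)) (fun l => (w l : ℝ) - (p l).toReal) ⟨l, by simpa⟩
  simp only [mem_filter, mem_univ, true_and] at hk hmax
  refine ⟨k, isValid_some hk fun j _ => ?_⟩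
  by_cases hj : p j ≤ (w j : ℝ≥0∞)
  · have h1 := hmax j hj
    lift p j to ℝ≥0 using ne_top_of_le_ne_top ENNReal.coe_ne_top hj with q
    lift p k to ℝ≥0 using ne_top_of_le_ne_top ENNReal.coe_ne_top hk with r
    simp only [ENNReal.coe_toReal] at h1
    norm_cast
    rw [← NNReal.coe_le_coe]
    push_cast
    linarith
  · rw [add_comm]
    exact add_le_add hk (not_le.1 hj).le

theorem exists_isValid (p : Fin n → ℝ≥0∞) (w : Fin n → ℝ≥0) : ∃ o, IsValid p w o := by
  by_cases h : ∃ l, p l ≤ (w l : ℝ≥0∞)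
  · obtain ⟨l, hl⟩ := exists_isValid_some h
    exact ⟨_, hl⟩
  · push Not at h
    refine ⟨none, by simp, fun ⟨l, hl⟩ => absurd hl (h l).le.not_gt⟩

/-- Any payment independent potential payments are those of a profit maximizer that breaks
ties in favour of revenue. -/
theorem exists_pp_eq (p : Fin n → (Fin n → ℝ≥0) → ℝ≥0∞)
    (hp : ∀ i v r, p i (Function.update v i r) = p i v) :
    ∃ M : PM n, M.pp = p ∧
      ∀ w o, IsValid (fun l => p l w) w o → payment (fun l => p l w) o ≤ M.rev w := by
  classical
  have h (w : Fin n → ℝ≥0) : ∃ o, IsValid (fun l => p l w) w o ∧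
      ∀ o', IsValid (fun l => p l w) w o' →
        payment (fun l => p l w) o' ≤ payment (fun l => p l w) o := by
    obtain ⟨o, ho⟩ := exists_isValid (fun l => p l w) w
    obtain ⟨k, hk, hmax⟩ := Finset.exists_max_image
      (univ.filter fun o => IsValid (fun l => p l w) w o) (payment fun l => p l w) ⟨o, by simpa⟩
    simp only [mem_filter, mem_univ, true_and] at hk hmax
    exact ⟨k, hk, hmax⟩
  choose a ha hmax using h
  exact ⟨⟨p, a, hp, fun w i hi => ((ha w).1 i hi).1, fun w i hi => ((ha w).1 i hi).2,
    fun w hw => (ha w).2 hw⟩, rfl, fun w o ho => hmax w o ho⟩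

theorem isValid_alloc (M : PM n) (w : Fin n → ℝ≥0) :
    IsValid (fun l => M.pp l w) w (M.alloc w) :=
  ⟨fun i hi => ⟨M.ir w i hi, M.maxProfit w i hi⟩, M.sells w⟩

/-- The potential payment of `l` depends only on the values of the others. -/
theorem pp_congr (M : PM n) (l : Fin n) {w w' : Fin n → ℝ≥0} (h : ∀ k, k ≠ l → w' k = w k) :
    M.pp l w' = M.pp l w := by
  rw [← M.indep l w (w' l)]
  congr 1
  funext k
  by_cases hk : k = l
  · subst hk; simp
  · simp [hk, h k hk]

end PM

namespace PM

/-- The revenue `p·(1 − F(p − ε))` of the price `p = kε` against a single buyer. -/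
noncomputable def priceRev (ε : ℝ≥0) (g : ℕ → ℝ) (k : ℕ) : ℝ :=
  (k : ℝ) * (ε : ℝ) * (1 - ∑ j ∈ Finset.range k, g j)

variable {m : ℕ} {ε : ℝ≥0} {g : ℕ → ℝ}

theorem one_sub_sum_range (hgsum : ∑ k ∈ Finset.range (m + 1), g k = 1) {a : ℕ}
    (ha : a ≤ m + 1) :
    1 - ∑ j ∈ Finset.range a, g j = ∑ j ∈ Finset.Ico a (m + 1), g j := by
  rw [Finset.sum_Ico_eq_sub _ ha, hgsum]

theorem one_sub_sum_range_nonneg (hgpos : ∀ k ≤ m, 0 < g k)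
    (hgsum : ∑ k ∈ Finset.range (m + 1), g k = 1) {a : ℕ} (ha : a ≤ m + 1) :
    0 ≤ 1 - ∑ j ∈ Finset.range a, g j := by
  rw [one_sub_sum_range hgsum ha]
  refine Finset.sum_nonneg fun j hj => (hgpos j ?_).le
  have := (Finset.mem_Ico.1 hj).2
  omega

theorem StandardD.mul_le (hstd : StandardD m ε g) (hgpos : ∀ k ≤ m, 0 < g k)
    {k k' : ℕ} (hk : k ≤ m) (hk' : k' < k) :
    g k * (k' * ε * g k' - ε * (1 - ∑ j ∈ Finset.range (k + 1), g j)) ≤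
      g k' * (k * ε * g k - ε * (1 - ∑ j ∈ Finset.range (k + 1), g j)) := by
  have h := hstd k k' hk hk'
  have h1 := hgpos k hk
  have h2 := hgpos k' (by omega)
  have := mul_le_mul_of_nonneg_left h (mul_pos h1 h2).le
  field_simp at this
  linarith

theorem priceRev_sub (k : ℕ) :
    priceRev ε g k - priceRev ε g (k + 1) =
      k * ε * g k - ε * (1 - ∑ j ∈ Finset.range (k + 1), g j) := by
  simp only [priceRev, Finset.sum_range_succ]
  push_cast
  ring

theorem priceRev_succ_le (hgpos : ∀ k ≤ m, 0 < g k)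
    (hgsum : ∑ k ∈ Finset.range (m + 1), g k = 1) (hstd : StandardD m ε g)
    {x : ℕ} (hx : MonopolistIdx m ε g x) {k : ℕ} (hxk : x ≤ k) (hk : k ≤ m) :
    priceRev ε g (k + 1) ≤ priceRev ε g k := by
  induction k, hxk using Nat.le_induction with
  | base =>
    rcases hk.lt_or_eq with h | h
    · exact hx.2 (x + 1) h
    · subst h
      simp only [priceRev, hgsum, sub_self, mul_zero]
      have := one_sub_sum_range_nonneg hgpos hgsum (Nat.le_succ x)
      positivity
  | succ k hxk ih =>
    have h1 := hstd.mul_le hgpos hk (Nat.lt_succ_self k)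
    have h2 := ih (by omega)
    rw [← sub_nonneg, priceRev_sub] at h2 ⊢
    rw [Finset.sum_range_succ _ (k + 1)] at h1 ⊢
    have hg := hgpos k (by omega)
    have hg' := hgpos (k + 1) hk
    refine nonneg_of_mul_nonneg_right (le_trans ?_ h1) hg
    refine mul_nonneg hg'.le (h2.trans ?_)
    have : 0 ≤ (ε : ℝ) * g (k + 1) := by positivity
    linarith

theorem priceRev_anti (hgpos : ∀ k ≤ m, 0 < g k)
    (hgsum : ∑ k ∈ Finset.range (m + 1), g k = 1) (hstd : StandardD m ε g)
    {x : ℕ} (hx : MonopolistIdx m ε g x) {a b : ℕ} (hxa : x ≤ a) (hab : a ≤ b)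
    (hb : b ≤ m + 1) : priceRev ε g b ≤ priceRev ε g a := by
  induction b, hab using Nat.le_induction with
  | base => exact le_rfl
  | succ b hab ih =>
    exact (priceRev_succ_le hgpos hgsum hstd hx (hxa.trans hab) (by omega)).trans
      (ih (by omega))

/-- A price above `Yε`, where `Y` is at least the monopolist price, earns at most the revenue
of the price `(Y + 1)ε`. -/
theorem sum_ite_le_priceRev (hε : 0 < ε) (hgpos : ∀ k ≤ m, 0 < g k)
    (hgsum : ∑ k ∈ Finset.range (m + 1), g k = 1) (hstd : StandardD m ε g)
    {x : ℕ} (hx : MonopolistIdx m ε g x) {Y : ℕ} (hxY : x ≤ Y) (hY : Y ≤ m)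
    {q : ℝ} (hq : Y * ε < q) :
    ∑ s ∈ Finset.Ico (Y + 1) (m + 1), g s * (if q ≤ s * ε then q else 0) ≤
      priceRev ε g (Y + 1) := by
  have hε' : (0 : ℝ) < ε := hε
  set A := ⌈q / ε⌉₊ with hA
  have hqA : q ≤ A * ε := (div_le_iff₀ hε').1 (Nat.le_ceil _)
  have hYA : Y + 1 ≤ A := Nat.lt_ceil.2 ((lt_div_iff₀ hε').2 hq)
  have hiff (s : ℕ) : q ≤ s * ε ↔ A ≤ s := by
    rw [hA, Nat.ceil_le, div_le_iff₀ hε']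
  simp only [hiff]
  by_cases hAm : A ≤ m + 1
  · refine le_trans ?_ (priceRev_anti hgpos hgsum hstd hx (by omega) hYA hAm)
    rw [priceRev, one_sub_sum_range hgsum hAm, ← Finset.sum_Ico_consecutive _ hYA hAm,
      Finset.sum_eq_zero (s := Finset.Ico (Y + 1) A), zero_add, Finset.mul_sum]
    · refine Finset.sum_le_sum fun s hs => ?_
      rw [Finset.mem_Ico] at hs
      rw [if_pos hs.1, mul_comm]
      exact mul_le_mul_of_nonneg_right hqA (hgpos s (by omega)).le
    · intro s hs
      rw [Finset.mem_Ico] at hs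
      rw [if_neg (by omega), mul_zero]
  · rw [Finset.sum_eq_zero]
    · have := one_sub_sum_range_nonneg hgpos hgsum (show Y + 1 ≤ m + 1 by omega)
      rw [priceRev]
      positivity
    · intro s hs
      rw [Finset.mem_Ico] at hs
      rw [if_neg (by omega), mul_zero]

/-- `D a s` stands for the change in revenue when the two players involved have values `aε` and
`sε`: the first player's price is raised from `p` to `Yε`, and the second player's price is
lowered to `Yε` when the first player's value lies in `T`. -/
theorem sum_mul_sum_nonneg (hε : 0 < ε) (hgpos : ∀ k ≤ m, 0 < g k)
    (hgsum : ∑ k ∈ Finset.range (m + 1), g k = 1) (hstd : StandardD m ε g)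
    {x : ℕ} (hx : MonopolistIdx m ε g x) {Y : ℕ} (hxY : x ≤ Y) (hY : Y ≤ m)
    {p : ℝ} (hp : p < Y * ε) (T : Finset ℕ) (hT : ∀ a ∈ T, p ≤ a * ε ∧ a < Y)
    (D : ℕ → ℕ → ℝ)
    (hnotMem : ∀ a ∉ T, ∀ s, s ≠ Y → 0 ≤ D a s)
    (hgt : ∀ a, Y < a → a ≤ m → Y * ε - p ≤ D a Y)
    (hle : ∀ a ∉ T, a ≤ Y → 0 ≤ D a Y)
    (hmem_eq : ∀ a ∈ T, Y * ε - p ≤ D a Y)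
    (hmem_lt : ∀ a ∈ T, ∀ s < Y, 0 ≤ D a s)
    (hmem_gt : ∀ a ∈ T, ∃ q : ℝ, Y * ε < q ∧
      ∀ s, Y < s → s ≤ m → Y * ε - (if q ≤ s * ε then q else 0) ≤ D a s) :
    0 ≤ ∑ a ∈ Finset.range (m + 1), ∑ s ∈ Finset.range (m + 1), g a * (g s * D a s) := by
  have hε' : (0 : ℝ) < ε := hε
  have hgY := hgpos Y hY
  set S := 1 - ∑ j ∈ Finset.range (Y + 1), g j with hS
  have hS' : S = ∑ j ∈ Finset.Ico (Y + 1) (m + 1), g j := one_sub_sum_range hgsum (by omega)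
  have hS0 : 0 ≤ S := one_sub_sum_range_nonneg hgpos hgsum (by omega)
  have hTm : ∀ a ∈ T, a ≤ m := fun a ha => by have := (hT a ha).2; omega
  have hsplit (f : ℕ → ℝ) : ∑ s ∈ Finset.range (m + 1), f s =
      ∑ s ∈ Finset.range Y, f s + f Y + ∑ s ∈ Finset.Ico (Y + 1) (m + 1), f s := by
    rw [← Finset.sum_range_succ, Finset.sum_range_add_sum_Ico _ (by omega)]
  have hg0 : ∀ a ∈ Finset.range (m + 1), 0 ≤ g a := fun a ha =>
    (hgpos a (by have := Finset.mem_range.1 ha; omega)).le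
  simp only [← Finset.mul_sum]
  have hrow {a : ℕ} {c : ℝ} (haT : a ∉ T) (h : c ≤ D a Y) :
      g Y * c ≤ ∑ s ∈ Finset.range (m + 1), g s * D a s := by
    refine (mul_le_mul_of_nonneg_left h hgY.le).trans ?_
    rw [← Finset.add_sum_erase _ _ (show Y ∈ Finset.range (m + 1) by simp; omega)]
    refine le_add_of_nonneg_right (Finset.sum_nonneg fun s hs => ?_)
    rw [Finset.mem_erase] at hs
    exact mul_nonneg (hg0 s hs.2) (hnotMem a haT s hs.1)
  have hrow_gt : ∀ a ∈ Finset.Ico (Y + 1) (m + 1),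
      g a * (g Y * (Y * ε - p)) ≤ g a * ∑ s ∈ Finset.range (m + 1), g s * D a s := by
    intro a ha
    rw [Finset.mem_Ico] at ha
    refine mul_le_mul_of_nonneg_left (hrow (fun h => ?_) (hgt a (by omega) (by omega)))
      (hgpos a (by omega)).le
    have := (hT a h).2
    omega
  have hrow_mem : ∀ a ∈ T,
      -(ε * S * g Y) ≤ g a * ∑ s ∈ Finset.range (m + 1), g s * D a s := by
    intro a ha
    obtain ⟨q, hq, hqD⟩ := hmem_gt a ha
    have h1 := sum_ite_le_priceRev hε hgpos hgsum hstd hx hxY hY hq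
    have h2 : ∑ s ∈ Finset.Ico (Y + 1) (m + 1), g s * (Y * ε - (if q ≤ s * ε then q else 0)) ≤
        ∑ s ∈ Finset.Ico (Y + 1) (m + 1), g s * D a s := by
      refine Finset.sum_le_sum fun s hs => ?_
      rw [Finset.mem_Ico] at hs
      exact mul_le_mul_of_nonneg_left (hqD s (by omega) (by omega)) (hgpos s (by omega)).le
    have h3 : 0 ≤ ∑ s ∈ Finset.range Y, g s * D a s := by
      refine Finset.sum_nonneg fun s hs => ?_
      rw [Finset.mem_range] at hs
      exact mul_nonneg (hgpos s (by omega)).le (hmem_lt a ha s hs)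
    have h4 := mul_le_mul_of_nonneg_left (hmem_eq a ha) hgY.le
    simp only [mul_sub, Finset.sum_sub_distrib, ← Finset.sum_mul] at h2
    rw [← hS'] at h2
    rw [priceRev, ← hS] at h1
    push_cast at h1
    have h5 : g Y * (Y * ε - p) - ε * S ≤ ∑ s ∈ Finset.range (m + 1), g s * D a s := by
      rw [hsplit]
      linarith
    have hga := hgpos a (hTm a ha)
    refine le_trans ?_ (mul_le_mul_of_nonneg_left h5 hga.le)
    have h6 := hstd.mul_le hgpos hY (hT a ha).2
    rw [← hS] at h6
    have h7 := mul_le_mul_of_nonneg_left (hT a ha).1 (mul_pos hga hgY).le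
    linarith
  have hdisj : Disjoint T (Finset.Ico (Y + 1) (m + 1)) := by
    rw [Finset.disjoint_left]
    intro a ha ha'
    have := (hT a ha).2
    have := (Finset.mem_Ico.1 ha').1
    omega
  have hcard : (T.card : ℝ) * ε ≤ Y * ε - p := by
    have hsub : T ⊆ Finset.Ico ⌈p / ε⌉₊ Y := fun a ha =>
      Finset.mem_Ico.2 ⟨Nat.ceil_le.2 ((div_le_iff₀ hε').2 (hT a ha).1), (hT a ha).2⟩
    have hc := Finset.card_le_card hsub
    rw [Nat.card_Ico] at hc
    have hpc : p ≤ ⌈p / ε⌉₊ * ε := (div_le_iff₀ hε').1 (Nat.le_ceil _)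
    have hY' : ⌈p / ε⌉₊ ≤ Y := Nat.ceil_le.2 ((div_le_iff₀ hε').2 hp.le)
    have hc' : (T.card : ℝ) ≤ Y - ⌈p / ε⌉₊ := by
      rw [← Nat.cast_sub hY']
      exact_mod_cast hc
    nlinarith
  have hsub : T ∪ Finset.Ico (Y + 1) (m + 1) ⊆ Finset.range (m + 1) := by
    intro a ha
    rcases Finset.mem_union.1 ha with h | h
    · exact Finset.mem_range.2 (Nat.lt_succ_of_le (hTm a h))
    · exact Finset.mem_range.2 (Finset.mem_Ico.1 h).2
  refine le_trans ?_ (Finset.sum_le_sum_of_subset_of_nonneg hsub ?_)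
  · rw [Finset.sum_union hdisj]
    refine le_trans ?_ (add_le_add (Finset.sum_le_sum hrow_mem) (Finset.sum_le_sum hrow_gt))
    rw [Finset.sum_const, ← Finset.sum_mul, ← hS', nsmul_eq_mul]
    have := mul_le_mul_of_nonneg_left hcard (mul_nonneg hS0 hgY.le)
    linarith
  · intro a ha ha'
    rw [Finset.mem_union, not_or, Finset.mem_Ico] at ha'
    have ham := Finset.mem_range.1 ha
    have := hrow ha'.1 (hle a ha'.1 (by omega))
    rw [mul_zero] at this
    exact mul_nonneg (hg0 a ha) this

end PM

namespace PM

variable {n : ℕ}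

theorem prod_update_update {i j : Fin n} (hij : i ≠ j) (f : ℕ → ℝ) {m : ℕ}
    (k : Fin n → Fin (m + 1)) (a s : Fin (m + 1)) :
    ∏ l, f (Function.update (Function.update k i a) j s l : ℕ) =
      f a * (f s * ∏ l ∈ (univ.erase j).erase i, f (k l : ℕ)) := by
  rw [← Finset.mul_prod_erase univ _ (mem_univ j),
    ← Finset.mul_prod_erase (univ.erase j) _ (Finset.mem_erase.2 ⟨hij, mem_univ i⟩)]
  have : ∏ l ∈ (univ.erase j).erase i, f (Function.update (Function.update k i a) j s l : ℕ) =
      ∏ l ∈ (univ.erase j).erase i, f (k l : ℕ) := by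
    refine Finset.prod_congr rfl fun l hl => ?_
    simp only [Finset.mem_erase] at hl
    rw [Function.update_of_ne hl.2.1, Function.update_of_ne hl.1]
  rw [this]
  simp only [Function.update_self, Function.update_of_ne hij]
  ring

/-- To compare expected revenues it suffices to compare revenues away from the instances that
agree with `v` off `i` and `j`, and in total over those instances. -/
theorem expRev_le_expRev {m : ℕ} {ε : ℝ≥0} {g : ℕ → ℝ} (hε : ε ≠ 0)
    (hgpos : ∀ k ≤ m, 0 < g k)
    (M M' : PM n) {i j : Fin n} (hij : i ≠ j) {v : Fin n → ℝ≥0} (hv : OnGrid m ε v)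
    (hout : ∀ w : Fin n → ℝ≥0, ¬ (∀ k, k ≠ i → k ≠ j → w k = v k) → M.rev w ≤ M'.rev w)
    (hin : 0 ≤ ∑ a ∈ Finset.range (m + 1), ∑ s ∈ Finset.range (m + 1), g a * (g s *
      (M'.rev (Function.update (Function.update v i (a * ε)) j (s * ε)) -
        M.rev (Function.update (Function.update v i (a * ε)) j (s * ε))))) :
    expRev m ε g M ≤ expRev m ε g M' := by
  classical
  have hv' : ∀ l, ∃ k : Fin (m + 1), v l = ((k : ℕ) : ℝ≥0) * ε := fun l => by
    obtain ⟨k, hk, h⟩ := hv l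
    exact ⟨⟨k, Nat.lt_succ_of_le hk⟩, h⟩
  choose k hk using hv'
  have hg0 (a : Fin (m + 1)) : 0 ≤ g a := (hgpos a (Nat.le_of_lt_succ a.2)).le
  let upd (c : Fin (m + 1) × Fin (m + 1)) : Fin n → Fin (m + 1) :=
    Function.update (Function.update k i c.1) j c.2
  have hinj : Function.Injective upd := by
    intro c c' h
    have h1 := congrFun h i
    have h2 := congrFun h j
    simp only [upd, Function.update_self, Function.update_of_ne hij] at h1 h2
    exact Prod.ext h1 h2
  have hupd (c : Fin (m + 1) × Fin (m + 1)) : (fun l => ((upd c l : ℕ) : ℝ≥0) * ε) =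
      Function.update (Function.update v i ((c.1 : ℕ) * ε)) j ((c.2 : ℕ) * ε) := by
    funext l
    by_cases hj : l = j
    · subst hj; simp [upd]
    · by_cases hi : l = i
      · subst hi; simp [upd, hj]
      · simp [upd, hj, hi, hk l]
  rw [← sub_nonneg, expRev, expRev, ← Finset.sum_sub_distrib]
  simp only [← mul_sub]
  refine le_trans ?_ (Finset.sum_le_sum_of_subset_of_nonneg
    (Finset.subset_univ (univ.image upd)) fun K _ hK => ?_)
  · rw [Finset.sum_image hinj.injOn, Fintype.sum_prod_type]
    simp only [hupd]
    simp only [upd, prod_update_update hij]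
    have hC : 0 ≤ ∏ l ∈ (univ.erase j).erase i, g (k l : ℕ) :=
      Finset.prod_nonneg fun l _ => hg0 (k l)
    rw [Finset.sum_range] at hin
    simp only [Finset.sum_range] at hin
    refine (mul_nonneg hC hin).trans_eq ?_
    rw [Finset.mul_sum]
    refine Finset.sum_congr rfl fun a _ => ?_
    rw [Finset.mul_sum]
    refine Finset.sum_congr rfl fun s _ => ?_
    ring
  · refine mul_nonneg (Finset.prod_nonneg fun l _ => hg0 (K l)) (sub_nonneg.2 (hout _ ?_))
    intro h
    refine hK (Finset.mem_image.2 ⟨(K i, K j), mem_univ _, ?_⟩)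
    funext l
    by_cases hj : l = j
    · subst hj; simp [upd]
    · by_cases hi : l = i
      · subst hi; simp [upd, hj]
      · have := h l hi hj
        rw [hk l] at this
        have := mul_right_cancel₀ hε this
        simp only [upd, Function.update_of_ne hj, Function.update_of_ne hi]
        exact Fin.ext (by exact_mod_cast this.symm)

end PM

namespace PM

variable {n : ℕ}

theorem rev_of_alloc_eq_some {M : PM n} {w : Fin n → ℝ≥0} {l : Fin n}
    (h : M.alloc w = some l) : M.rev w = (M.pp l w).toReal := by
  simp [rev, h]

theorem rev_of_alloc_eq_none {M : PM n} {w : Fin n → ℝ≥0} (h : M.alloc w = none) :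
    M.rev w = 0 := by
  simp [rev, h]

theorem alloc_eq_none_or_eq_some {M : PM n} {w : Fin n → ℝ≥0} {l : Fin n}
    (h : ∀ k, k ≠ l → (w k : ℝ≥0∞) < M.pp k w) :
    M.alloc w = none ∨ M.alloc w = some l := by
  rcases hw : M.alloc w with _ | k
  · exact .inl rfl
  · right
    by_contra hk
    exact (h k fun h => hk (by rw [h])).not_ge (M.ir w k hw)

theorem le_pp_of_alloc_eq_none {M : PM n} {w : Fin n → ℝ≥0} (h : M.alloc w = none)
    (l : Fin n) : (w l : ℝ≥0∞) ≤ M.pp l w := by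
  by_contra hl
  exact M.sells w ⟨l, not_le.1 hl⟩ h

/-- The values below `max(v₋ᵢ)` at which player `i` wins against `v₋ᵢ` and nobody else would
be willing to buy. -/
def soleSales (M : PM n) (i : Fin n) (v : Fin n → ℝ≥0) : Set ℝ≥0 :=
  {t | t < maxOther i v ∧ M.alloc (Function.update v i t) = some i ∧
    ∀ k, k ≠ i → (v k : ℝ≥0∞) < M.pp k (Function.update v i t)}

open Classical in
/-- The potential payments of `M`, where the price of `i` given `v₋ᵢ` is replaced by
`max(v₋ᵢ)`, and so is the price of `j` at the instances where `i` loses sole sales. -/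
noncomputable def shiftPP (M : PM n) (i j : Fin n) (v : Fin n → ℝ≥0) (l : Fin n)
    (w : Fin n → ℝ≥0) : ℝ≥0∞ :=
  if l = i ∧ ∀ k, k ≠ i → w k = v k then (maxOther i v : ℝ≥0∞)
  else if l = j ∧ (∀ k, k ≠ i → k ≠ j → w k = v k) ∧ w i ∈ M.soleSales i v then
    (maxOther i v : ℝ≥0∞)
  else M.pp l w

variable {M : PM n} {i j : Fin n} {v w : Fin n → ℝ≥0}

theorem shiftPP_update (hij : i ≠ j) (l : Fin n) (w : Fin n → ℝ≥0) (r : ℝ≥0) :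
    M.shiftPP i j v l (Function.update w l r) = M.shiftPP i j v l w := by
  classical
  have h1 : (l = i ∧ ∀ k, k ≠ i → Function.update w l r k = v k) ↔
      (l = i ∧ ∀ k, k ≠ i → w k = v k) := by
    refine and_congr_right fun hl => forall_congr' fun k => imp_congr_right fun hk => ?_
    rw [Function.update_of_ne (hl ▸ hk)]
  have h2 : (l = j ∧ (∀ k, k ≠ i → k ≠ j → Function.update w l r k = v k) ∧
      Function.update w l r i ∈ M.soleSales i v) ↔
      (l = j ∧ (∀ k, k ≠ i → k ≠ j → w k = v k) ∧ w i ∈ M.soleSales i v) := by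
    refine and_congr_right fun hl => and_congr (forall_congr' fun k =>
      imp_congr_right fun _ => imp_congr_right fun hk => ?_) ?_
    · rw [Function.update_of_ne (hl ▸ hk)]
    · rw [Function.update_of_ne (hl ▸ hij)]
  rw [shiftPP, shiftPP, M.indep]
  exact if_congr h1 rfl (if_congr h2 rfl rfl)

theorem shiftPP_self (hw : ∀ k, k ≠ i → w k = v k) :
    M.shiftPP i j v i w = maxOther i v := by
  rw [shiftPP, if_pos ⟨rfl, hw⟩]

theorem shiftPP_other (hij : i ≠ j) (hw : ∀ k, k ≠ i → k ≠ j → w k = v k)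
    (hi : w i ∈ M.soleSales i v) : M.shiftPP i j v j w = maxOther i v := by
  rw [shiftPP, if_neg fun h => hij h.1.symm, if_pos ⟨rfl, hw, hi⟩]

theorem shiftPP_of_ne {l : Fin n} (hi : l ≠ i) (hj : l ≠ j) :
    M.shiftPP i j v l w = M.pp l w := by
  rw [shiftPP, if_neg fun h => hi h.1, if_neg fun h => hj h.1]

theorem shiftPP_of_ne_of_notMem {l : Fin n} (hl : l ≠ i) (hi : w i ∉ M.soleSales i v) :
    M.shiftPP i j v l w = M.pp l w := by
  rw [shiftPP, if_neg fun h => hl h.1, if_neg fun h => hi h.2.2]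

theorem shiftPP_of_ne_apply {l : Fin n} (hl : l ≠ j) (hij : i ≠ j) (hj : w j ≠ v j) :
    M.shiftPP i j v l w = M.pp l w := by
  rw [shiftPP, if_neg fun h => hj (h.2 j hij.symm), if_neg fun h => hl h.1]

theorem shiftPP_of_not_agree (hw : ¬ ∀ k, k ≠ i → k ≠ j → w k = v k) (l : Fin n) :
    M.shiftPP i j v l w = M.pp l w := by
  rw [shiftPP, if_neg fun h => hw fun k hi _ => h.2 k hi, if_neg fun h => hw h.2.1]

variable {M' : PM n}
  (hM' : ∀ w o, IsValid (fun l => M.shiftPP i j v l w) w o →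
    payment (fun l => M.shiftPP i j v l w) o ≤ M'.rev w)

include hM'

theorem rev_le_of_shiftPP_eq (h : ∀ l, M.shiftPP i j v l w = M.pp l w) :
    M.rev w ≤ M'.rev w := by
  have := hM' w (M.alloc w)
  simp only [h] at this
  exact this (M.isValid_alloc w)

theorem rev_le_of_ge_of_notMem (hij : i ≠ j) (hw : ∀ k, k ≠ i → w k = v k)
    {p : ℝ≥0} (hp : M.pp i v = p) (hpy : p ≤ maxOther i v)
    (hlt : ∀ l, l ≠ i → v l < w i → (w i : ℝ≥0∞) ≤ M.pp l w)
    (hwi : w i ≤ maxOther i v) (hT : w i ∉ M.soleSales i v) : M.rev w ≤ M'.rev w := by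
  have hpi : M.pp i w = p := (M.pp_congr i hw).trans hp
  have hsi : M.shiftPP i j v i w = maxOther i v := shiftPP_self hw
  have hsl {l : Fin n} (hl : l ≠ i) : M.shiftPP i j v l w = M.pp l w :=
    shiftPP_of_ne_of_notMem hl hT
  have hmono (l : Fin n) : M.pp l w ≤ M.shiftPP i j v l w := by
    by_cases hl : l = i
    · subst hl
      rw [hsi, hpi]
      exact_mod_cast hpy
    · rw [hsl hl]
  have hupd : w = Function.update v i (w i) := by
    funext k
    by_cases hk : k = i
    · subst hk; simp
    · simp [hk, hw k hk]
  rcases hal : M.alloc w with _ | l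
  · rw [rev_of_alloc_eq_none hal]
    refine hM' w none ⟨by simp, fun ⟨l, hl⟩ => absurd hl ?_⟩
    exact ((le_pp_of_alloc_eq_none hal l).trans (hmono l)).not_gt
  by_cases hli : l = i
  · subst hli
    rw [rev_of_alloc_eq_some hal, hpi]
    have hex : ∃ k, M.shiftPP l j v k w ≤ w k := by
      rcases hwi.lt_or_eq with h | h
      · have : ¬ ∀ k, k ≠ l → (v k : ℝ≥0∞) < M.pp k w := by
          intro h'
          rw [hupd] at hal h'
          exact hT ⟨h, hal, h'⟩
        push Not at this
        obtain ⟨k, hk, hkv⟩ := this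
        refine ⟨k, ?_⟩
        rwa [hsl hk, hw k hk]
      · exact ⟨l, by rw [hsi, h]⟩
    obtain ⟨o, ho⟩ := exists_isValid_some hex
    refine le_trans ?_ (hM' w _ ho)
    have hole := (ho.1 o rfl).1
    change _ ≤ (M.shiftPP l j v o w).toReal
    refine ENNReal.toReal_mono (ne_top_of_le_ne_top ENNReal.coe_ne_top hole) ?_
    by_cases ho' : o = l
    · subst ho'
      rw [hsi]
      exact_mod_cast hpy
    · simp only [hsl ho'] at hole ⊢
      have hvo : w l ≤ w o := by
        by_contra hlt'
        rw [not_le] at hlt'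
        have := (hlt o ho' (by rwa [hw o ho'] at hlt')).trans hole
        exact hlt'.not_ge (by exact_mod_cast this)
      have hmax := M.maxProfit w l hal o
      rw [hpi] at hmax
      refine (ENNReal.add_le_add_iff_left (a := (w l : ℝ≥0∞)) ENNReal.coe_ne_top).1 ?_
      refine le_trans ?_ hmax
      gcongr
  · refine le_trans ?_ (hM' w (some l) (isValid_some ?_ fun k _ => ?_))
    · rw [rev_of_alloc_eq_some hal]
      change _ ≤ (M.shiftPP i j v l w).toReal
      rw [hsl hli]
    · rw [hsl hli]
      exact M.ir w l hal
    · rw [hsl hli]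
      exact (M.maxProfit w l hal k).trans (by gcongr; exact hmono k)

theorem maxOther_sub_le_rev_sub_of_gt (hw : ∀ k, k ≠ i → w k = v k)
    {p : ℝ≥0} (hp : M.pp i v = p)
    (hlt : ∀ l, l ≠ i → v l < w i → (w i : ℝ≥0∞) ≤ M.pp l w)
    (hwi : maxOther i v < w i) : (maxOther i v : ℝ) - p ≤ M'.rev w - M.rev w := by
  have hpi : M.pp i w = p := (M.pp_congr i hw).trans hp
  have hsi : M.shiftPP i j v i w = maxOther i v := shiftPP_self hw
  have hT : w i ∉ M.soleSales i v := fun h => h.1.not_gt hwi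
  have hvl {l : Fin n} (hl : l ≠ i) : v l ≤ maxOther i v :=
    Finset.le_sup (f := v) (Finset.mem_erase.2 ⟨hl, mem_univ l⟩)
  have hpl {l : Fin n} (hl : l ≠ i) : (w i : ℝ≥0∞) ≤ M.pp l w :=
    hlt l hl ((hvl hl).trans_lt hwi)
  have hle : M.rev w ≤ p := by
    rcases M.alloc_eq_none_or_eq_some (w := w) (l := i) fun l hl => by
      rw [hw l hl]
      exact lt_of_lt_of_le (by exact_mod_cast (hvl hl).trans_lt hwi) (hpl hl) with h | h
    · rw [rev_of_alloc_eq_none h]; positivity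
    · rw [rev_of_alloc_eq_some h, hpi]; simp
  have hge : (maxOther i v : ℝ) ≤ M'.rev w := by
    refine le_trans (le_of_eq ?_) (hM' w (some i) (isValid_some ?_ fun l hl => ?_))
    · change _ = (M.shiftPP i j v i w).toReal
      rw [hsi]; simp
    · rw [hsi]; exact_mod_cast hwi.le
    · rw [hsi, shiftPP_of_ne_of_notMem hl hT, add_comm]
      refine add_le_add (by exact_mod_cast hwi.le) (le_trans ?_ (hpl hl))
      rw [hw l hl]
      exact_mod_cast (hvl hl).trans hwi.le
  linarith

theorem maxOther_sub_le_rev_sub_of_mem (hij : i ≠ j) (hw : ∀ k, k ≠ i → w k = v k)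
    (hjv : v j = maxOther i v) {p : ℝ≥0} (hp : M.pp i v = p)
    (hT : w i ∈ M.soleSales i v) : (maxOther i v : ℝ) - p ≤ M'.rev w - M.rev w := by
  have hupd : w = Function.update v i (w i) := by
    funext k
    by_cases hk : k = i
    · subst hk; simp
    · simp [hk, hw k hk]
  have hal := hT.2.1
  have hoth := hT.2.2
  rw [← hupd] at hal hoth
  have hsi : M.shiftPP i j v i w = maxOther i v := shiftPP_self hw
  have hsj : M.shiftPP i j v j w = maxOther i v := shiftPP_other hij (fun k hk _ => hw k hk) hT
  have hle : M.rev w = p := by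
    rw [rev_of_alloc_eq_some hal, M.pp_congr i hw, hp]; simp
  have hge : (maxOther i v : ℝ) ≤ M'.rev w := by
    refine le_trans (le_of_eq ?_) (hM' w (some j) (isValid_some ?_ fun l hl => ?_))
    · change _ = (M.shiftPP i j v j w).toReal
      rw [hsj]; simp
    · rw [hsj, hw j hij.symm, hjv]
    · rw [hsj, hw j hij.symm, hjv, add_comm]
      by_cases hli : l = i
      · subst hli
        rw [hsi]
        gcongr
        exact hT.1.le
      · rw [shiftPP_of_ne hli hl, hw l hli]
        gcongr
        exact (hoth l hli).le
  linarith

theorem rev_le_of_lt_of_mem (hij : i ≠ j) (hw : ∀ k, k ≠ i → k ≠ j → w k = v k)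
    (hjv : v j = maxOther i v) (hT : w i ∈ M.soleSales i v) (hwj : w j < maxOther i v) :
    M.rev w ≤ M'.rev w := by
  have hsj : M.shiftPP i j v j w = maxOther i v := shiftPP_other hij hw hT
  have hsl {l : Fin n} (hl : l ≠ j) : M.shiftPP i j v l w = M.pp l w :=
    shiftPP_of_ne_apply hl hij (by rw [hjv]; exact hwj.ne)
  have hq : (maxOther i v : ℝ≥0∞) < M.pp j w := by
    have := hT.2.2 j hij.symm
    rw [← hjv]
    refine this.trans_eq (M.pp_congr j fun k hk => ?_)
    by_cases hi : k = i
    · subst hi; simp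
    · simp [hi, hw k hi hk]
  have hwj' : (w j : ℝ≥0∞) < maxOther i v := by exact_mod_cast hwj
  rcases hal : M.alloc w with _ | l
  · rw [rev_of_alloc_eq_none hal]
    refine hM' w none ⟨by simp, fun ⟨l, hl⟩ => absurd hl (not_lt.2 ?_)⟩
    change (w l : ℝ≥0∞) ≤ M.shiftPP i j v l w
    by_cases hlj : l = j
    · subst hlj
      rw [hsj]
      exact hwj'.le
    · rw [hsl hlj]
      exact le_pp_of_alloc_eq_none hal l
  · have hlj : l ≠ j := by
      rintro rfl
      exact (M.ir w l hal).not_gt (hwj'.trans hq)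
    rw [rev_of_alloc_eq_some hal]
    refine le_trans (le_of_eq ?_) (hM' w (some l) (isValid_some ?_ fun k _ => ?_))
    · change _ = (M.shiftPP i j v l w).toReal
      rw [hsl hlj]
    · rw [hsl hlj]
      exact M.ir w l hal
    · rw [hsl hlj]
      by_cases hkj : k = j
      · subst hkj
        rw [hsj, add_comm]
        exact add_le_add (M.ir w l hal) hwj'.le
      · rw [hsl hkj]
        exact M.maxProfit w l hal k

theorem maxOther_sub_ite_le_rev_sub (hij : i ≠ j) (hw : ∀ k, k ≠ i → k ≠ j → w k = v k)
    (hjv : v j = maxOther i v) (hT : w i ∈ M.soleSales i v) (hwj : maxOther i v < w j)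
    (hlt : ∀ l, l ≠ j → (w j : ℝ≥0∞) ≤ M.pp l w) :
    (maxOther i v : ℝ) - (if M.pp j w ≤ w j then (M.pp j w).toReal else 0) ≤
      M'.rev w - M.rev w := by
  have hsj : M.shiftPP i j v j w = maxOther i v := shiftPP_other hij hw hT
  have hsl {l : Fin n} (hl : l ≠ j) : M.shiftPP i j v l w = M.pp l w :=
    shiftPP_of_ne_apply hl hij (by rw [hjv]; exact hwj.ne')
  have hwl {l : Fin n} (hl : l ≠ j) : w l < w j := by
    by_cases hli : l = i
    · subst hli
      exact hT.1.trans hwj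
    · rw [hw l hli hl]
      exact (Finset.le_sup (f := v) (Finset.mem_erase.2 ⟨hli, mem_univ l⟩)).trans_lt hwj
  have hle : M.rev w ≤ if M.pp j w ≤ w j then (M.pp j w).toReal else 0 := by
    rcases M.alloc_eq_none_or_eq_some (w := w) (l := j) fun l hl =>
      lt_of_lt_of_le (by exact_mod_cast hwl hl) (hlt l hl) with h | h
    · rw [rev_of_alloc_eq_none h]
      split_ifs <;> simp
    · rw [rev_of_alloc_eq_some h, if_pos (M.ir w j h)]
  have hge : (maxOther i v : ℝ) ≤ M'.rev w := by
    refine le_trans (le_of_eq ?_) (hM' w (some j) (isValid_some ?_ fun l hl => ?_))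
    · change _ = (M.shiftPP i j v j w).toReal
      rw [hsj]; simp
    · rw [hsj]; exact_mod_cast hwj.le
    · rw [hsj, hsl hl, add_comm]
      refine add_le_add (by exact_mod_cast hwj.le) (le_trans ?_ (hlt l hl))
      exact_mod_cast (hwl hl).le
  linarith

end PM

theorem stmt13 (n m : ℕ) (hm : 0 < m) (ε : ℝ≥0) (hε : (ε : ℝ) = 1 / m)
    (g : ℕ → ℝ) (hgpos : ∀ k ≤ m, 0 < g k)
    (hgsum : ∑ k ∈ Finset.range (m + 1), g k = 1)
    (hstd : PM.StandardD m ε g)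
    (x : ℕ) (hx : PM.MonopolistIdx m ε g x)
    (M : PM n) (hMmax : PM.RevMax m ε g M)
    (i : Fin n) (v : Fin n → ℝ≥0) (hv : PM.OnGrid m ε v)
    (hvx : (x : ℝ≥0) * ε ≤ PM.maxOther i v)
    (hprev : ∀ (j : Fin n) (w : Fin n → ℝ≥0), PM.OnGrid m ε w →
      PM.SuccOrd j w i v → (PM.maxOther j w : ℝ≥0∞) ≤ M.pp j w) :
    ∃ M' : PM n,
      (∀ (j : Fin n) (w : Fin n → ℝ≥0), PM.OnGrid m ε w →
        PM.SuccOrd j w i v → (PM.maxOther j w : ℝ≥0∞) ≤ M'.pp j w) ∧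
      (PM.maxOther i v : ℝ≥0∞) ≤ M'.pp i v ∧
      PM.expRev m ε g M ≤ PM.expRev m ε g M' := by
  classical
  have hε0 : 0 < ε := by
    rw [← NNReal.coe_pos, hε]
    positivity
  by_cases hpi : (PM.maxOther i v : ℝ≥0∞) ≤ M.pp i v
  · exact ⟨M, hprev, hpi, le_rfl⟩
  rw [not_le] at hpi
  obtain ⟨p, hp⟩ : ∃ p : ℝ≥0, (p : ℝ≥0∞) = M.pp i v :=
    ⟨_, ENNReal.coe_toNNReal hpi.ne_top⟩
  have hpy : p < PM.maxOther i v := by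
    rw [← hp] at hpi
    exact_mod_cast hpi
  obtain ⟨j, hj, hjv⟩ : ∃ j ∈ univ.erase i, PM.maxOther i v = v j := by
    refine Finset.exists_mem_eq_sup _ (Finset.nonempty_iff_ne_empty.2 fun h => ?_) v
    rw [PM.maxOther, h, Finset.sup_empty] at hpy
    exact not_lt_bot hpy
  have hij : i ≠ j := (Finset.ne_of_mem_erase hj).symm
  obtain ⟨Y, hY, hYv⟩ := hv j
  have hmax : PM.maxOther i v = Y * ε := hjv.trans hYv
  have hmaxR : (PM.maxOther i v : ℝ) = Y * ε := by rw [hmax]; push_cast; rfl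
  have hltY {a : ℕ} : (a : ℝ≥0) * ε < PM.maxOther i v ↔ a < Y := by
    rw [hmax, mul_lt_mul_iff_left₀ hε0, Nat.cast_lt]
  have hgtY {a : ℕ} : PM.maxOther i v < (a : ℝ≥0) * ε ↔ Y < a := by
    rw [hmax, mul_lt_mul_iff_left₀ hε0, Nat.cast_lt]
  have hxY : x ≤ Y := by
    rw [← not_lt, ← hgtY, not_lt]
    exact hvx
  obtain ⟨M', hpp, hM'⟩ := PM.exists_pp_eq (M.shiftPP i j v) (PM.shiftPP_update hij)
  refine ⟨M', fun l w hw hlw => ?_, ?_, ?_⟩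
  · rw [hpp, PM.shiftPP]
    split_ifs with h1 h2
    · obtain ⟨rfl, h1⟩ := h1
      rw [PM.SuccOrd, PM.sortedDel_congr h1] at hlw
      exact absurd hlw (irrefl_of (List.Lex ((· < ·) : ℝ≥0 → ℝ≥0 → Prop)) _)
    · obtain ⟨rfl, h1, h2⟩ := h2
      refine absurd hlw (PM.succOrd_asymm (PM.succOrd_of_lt hij.symm
        (fun k hk hk' => (h1 k hk' hk).symm) ?_))
      rw [← hjv]
      exact h2.1
    · exact hprev l w hw hlw
  · rw [hpp, PM.shiftPP_self fun _ _ => rfl]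
  let N (a s : ℕ) : Fin n → ℝ≥0 := Function.update (Function.update v i (a * ε)) j (s * ε)
  have hNi (a s : ℕ) : N a s i = a * ε := by simp [N, hij]
  have hNj (a s : ℕ) : N a s j = s * ε := by simp [N]
  have hN (a s : ℕ) : ∀ k, k ≠ i → k ≠ j → N a s k = v k := fun k hi hj => by simp [N, hi, hj]
  have hNY (a : ℕ) : ∀ k, k ≠ i → N a Y k = v k := fun k hi => by
    by_cases hj : k = j
    · rw [hj, hNj, hYv]
    · exact hN a Y k hi hj
  have hNgrid {a s : ℕ} (ha : a ≤ m) (hs : s ≤ m) : PM.OnGrid m ε (N a s) := fun l => by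
    by_cases hi : l = i
    · exact ⟨a, ha, by rw [hi, hNi]⟩
    · by_cases hj : l = j
      · exact ⟨s, hs, by rw [hj, hNj]⟩
      · rw [hN a s l hi hj]
        exact hv l
  have hle_pp {l k : Fin n} {w : Fin n → ℝ≥0} (hw : PM.OnGrid m ε w) (hlw : PM.SuccOrd l w i v)
      (hk : k ≠ l) : (w k : ℝ≥0∞) ≤ M.pp l w := by
    refine le_trans ?_ (hprev l w hw hlw)
    exact_mod_cast Finset.le_sup (f := w) (Finset.mem_erase.2 ⟨hk, mem_univ k⟩)
  have hblock {a : ℕ} (ha : a ≤ m) : ∀ l, l ≠ i → v l < N a Y i →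
      (N a Y i : ℝ≥0∞) ≤ M.pp l (N a Y) := fun l hl hlt =>
    hle_pp (hNgrid ha hY) (PM.succOrd_of_lt hl.symm (fun k hk _ => hNY a k hk) hlt) hl.symm
  refine PM.expRev_le_expRev hε0.ne' hgpos M M' hij hv
    (fun w hw => PM.rev_le_of_shiftPP_eq hM' fun l => PM.shiftPP_of_not_agree hw l) ?_
  let T : Finset ℕ := (Finset.range Y).filter fun a => (a : ℝ≥0) * ε ∈ M.soleSales i v
  have hT {a : ℕ} : a ∈ T ↔ (a : ℝ≥0) * ε ∈ M.soleSales i v := by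
    simp only [T, Finset.mem_filter, Finset.mem_range, and_iff_right_iff_imp]
    exact fun h => hltY.1 h.1
  have hTN {a : ℕ} (s : ℕ) : a ∈ T ↔ N a s i ∈ M.soleSales i v := by rw [hT, hNi]
  refine PM.sum_mul_sum_nonneg hε0 hgpos hgsum hstd hx hxY hY (p := p)
    (by rw [← hmaxR]; exact_mod_cast hpy) T (fun a ha => ⟨?_, hltY.1 (hT.1 ha).1⟩)
    (fun a s => M'.rev (N a s) - M.rev (N a s)) ?_ ?_ ?_ ?_ ?_ ?_
  · have h := M.ir _ _ (hT.1 ha).2.1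
    rw [M.indep, ← hp, Function.update_self] at h
    exact_mod_cast h
  · intro a ha s hs
    refine sub_nonneg.2 (PM.rev_le_of_shiftPP_eq hM' fun l => ?_)
    by_cases hl : l = i
    · subst hl
      refine PM.shiftPP_of_ne_apply hij hij ?_
      rw [hNj, hYv]
      exact fun h => hs (by exact_mod_cast mul_right_cancel₀ hε0.ne' h)
    · exact PM.shiftPP_of_ne_of_notMem hl fun h => ha ((hTN s).2 h)
  · intro a ha ham
    rw [← hmaxR]
    exact PM.maxOther_sub_le_rev_sub_of_gt hM' (hNY a) hp.symm (hblock ham)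
      (by rw [hNi]; exact hgtY.2 ha)
  · intro a ha haY
    exact sub_nonneg.2 (PM.rev_le_of_ge_of_notMem hM' hij (hNY a) hp.symm hpy.le
      (hblock (haY.trans hY)) (by rw [hNi, ← not_lt, hgtY]; omega) fun h => ha ((hTN Y).2 h))
  · intro a ha
    rw [← hmaxR]
    exact PM.maxOther_sub_le_rev_sub_of_mem hM' hij (hNY a) hjv.symm hp.symm ((hTN Y).1 ha)
  · intro a ha s hs
    exact sub_nonneg.2 (PM.rev_le_of_lt_of_mem hM' hij (hN a s) hjv.symm ((hTN s).1 ha)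
      (by rw [hNj]; exact hltY.2 hs))
  · intro a ha
    have haY : a < Y := hltY.1 (hT.1 ha).1
    have hq : (PM.maxOther i v : ℝ≥0∞) < M.pp j (N a Y) := by
      have h := (hT.1 ha).2.2 j hij.symm
      rw [← hjv] at h
      refine h.trans_eq (M.pp_congr j fun k hk => ?_)
      simp [N, hk]
    have hqN (s : ℕ) : M.pp j (N a s) = M.pp j (N a Y) :=
      M.pp_congr j fun k hk => by simp [N, hk]
    have hD {s : ℕ} (hs : Y < s) (hsm : s ≤ m) :=
      PM.maxOther_sub_ite_le_rev_sub hM' hij (hN a s) hjv.symm ((hTN s).1 ha)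
        (by rw [hNj]; exact hgtY.2 hs) fun l hl =>
        hle_pp (hNgrid (haY.le.trans hY) hsm) (PM.succOrd_of_maxOther_lt hl.symm
          (by rw [hNj]; exact hgtY.2 hs)) hl.symm
    simp only [hqN, hNj, hmaxR] at hD
    rcases eq_or_ne (M.pp j (N a Y)) ⊤ with htop | htop
    · refine ⟨(m + 1 : ℕ) * ε, ?_, fun s hs hsm => ?_⟩
      · exact mul_lt_mul_of_pos_right (by exact_mod_cast Nat.lt_succ_of_le hY) hε0
      · have h := hD hs hsm
        rw [htop, if_neg (not_le.2 ENNReal.coe_lt_top)] at h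
        rwa [if_neg]
        rw [not_le]
        exact mul_lt_mul_of_pos_right (by exact_mod_cast Nat.lt_succ_of_le hsm) hε0
    · obtain ⟨q, hq'⟩ : ∃ q : ℝ≥0, (q : ℝ≥0∞) = M.pp j (N a Y) :=
        ⟨_, ENNReal.coe_toNNReal htop⟩
      rw [← hq'] at hq
      simp only [← hq', ENNReal.coe_le_coe, ENNReal.coe_toReal] at hD
      refine ⟨q, ?_, fun s hs hsm => ?_⟩
      · rw [← hmaxR]
        exact_mod_cast hq
      · have h := hD hs hsm
        simp only [← NNReal.coe_le_coe] at h
        push_cast at h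
        exact h
end
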